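/- arXiv:0907.1024 — 2 statements merged into one kernel-verified Lean document; each statement's English description precedes it below -/
import Mathlib

section
/- Let a < b be real numbers and 0 < α < 1. If f, g, the left Riemann–Liouville fractional derivative ₐD_x^α g, and the right Riemann–Liouville fractional derivative ₓD_b^α f are all continuous on [a,b], then ∫_a^b g(x) · (ₐD_x^α f)(x) dx = ∫_a^b f(x) · (ₓD_b^α g)(x) dx (fractional integration by parts for Riemann–Liouville fractional derivatives). -/
open MeasureTheory Set

/-- Left Riemann-Liouville fractional integral of order `α`. -/
noncomputable def leftRLFI (a : ℝ) (α : ℝ) (f : ℝ → ℝ) (x : ℝ) : ℝ :=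
  (1 / Real.Gamma α) * ∫ t in a..x, (x - t) ^ (α - 1) * f t

/-- Right Riemann-Liouville fractional integral of order `α`. -/
noncomputable def rightRLFI (b : ℝ) (α : ℝ) (f : ℝ → ℝ) (x : ℝ) : ℝ :=
  (1 / Real.Gamma α) * ∫ t in x..b, (t - x) ^ (α - 1) * f t

/-- Left Riemann-Liouville fractional derivative of order `α ∈ (0,1)`. -/
noncomputable def leftRLFD (a : ℝ) (α : ℝ) (f : ℝ → ℝ) (x : ℝ) : ℝ :=
  deriv (leftRLFI a (1 - α) f) x

/-- Right Riemann-Liouville fractional derivative of order `α ∈ (0,1)`. -/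
noncomputable def rightRLFD (b : ℝ) (α : ℝ) (f : ℝ → ℝ) (x : ℝ) : ℝ :=
  - deriv (rightRLFI b (1 - α) f) x

open Filter Topology AbsolutelyContinuousOnInterval in
/-- A pointwise limit of primitives of functions that are bounded by the sum of an `L²`-bounded
family and a fixed integrable function is absolutely continuous. -/
theorem absolutelyContinuousOnInterval_of_tendsto_integral {a b C : ℝ} (hab : a ≤ b)
    {V H : ℕ → ℝ → ℝ} {m u : ℝ → ℝ}
    (hV : ∀ n, IntervalIntegrable (V n) volume a b)
    (hH : ∀ n, IntervalIntegrable (fun x => H n x ^ 2) volume a b)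
    (hC : ∀ n, ∫ x in a..b, H n x ^ 2 ≤ C)
    (hm : IntervalIntegrable m volume a b)
    (hbd : ∀ n, ∀ᵐ x, x ∈ Ioc a b → |V n x| ≤ |H n x| + m x)
    (hu : ∀ x ∈ Icc a b, Tendsto (fun n => ∫ t in a..x, V n t) atTop (𝓝 (u x))) :
    AbsolutelyContinuousOnInterval u a b := by
  set μ := volume.restrict (Ioc a b) with hμ
  have hV' : ∀ n, Integrable (V n) μ := fun n =>
    (intervalIntegrable_iff_integrableOn_Ioc_of_le hab).1 (hV n)
  have hH' : ∀ n, Integrable (fun x => H n x ^ 2) μ :=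
    fun n => (intervalIntegrable_iff_integrableOn_Ioc_of_le hab).1 (hH n)
  have hm' : Integrable m μ := (intervalIntegrable_iff_integrableOn_Ioc_of_le hab).1 hm
  have hC' : ∀ n, ∫ x, H n x ^ 2 ∂μ ≤ C := fun n => by
    have := hC n; rwa [intervalIntegral.integral_of_le hab] at this
  have hC0 : 0 ≤ C := (integral_nonneg fun x => sq_nonneg _).trans (hC' 0)
  set s : ℕ × (ℕ → ℝ × ℝ) → Set ℝ := fun E =>
    ⋃ i ∈ Finset.range E.1, uIoc (E.2 i).1 (E.2 i).2 with hs
  have hsm : ∀ E, MeasurableSet (s E) := fun E =>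
    Finset.measurableSet_biUnion _ fun i _ => measurableSet_uIoc
  unfold AbsolutelyContinuousOnInterval
  rw [Metric.tendsto_nhds]
  intro η hη
  set l := η / (4 * (C + 1)) with hl
  have hl0 : 0 < l := by positivity
  have hlC : l * C ≤ η / 4 := by
    rw [hl, div_mul_eq_mul_div, div_le_div_iff₀ (by positivity) (by norm_num)]; nlinarith
  have hm2 : Integrable (fun x => 1 / (4 * l) + m x) μ := (integrable_const _).add hm'
  have ht : Tendsto (fun E => ∫ x in s E, (1 / (4 * l) + m x) ∂μ)
      (totalLengthFilter ⊓ 𝓟 (disjWithin a b)) (𝓝 0) := by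
    apply hm2.tendsto_setIntegral_nhds_zero
    have := tendsto_volume_restrict_totalLengthFilter_disjWithin_nhds_zero a b
    rwa [uIoc_of_le hab] at this
  have hdisj : ∀ᶠ E in totalLengthFilter ⊓ 𝓟 (disjWithin a b), E ∈ disjWithin a b :=
    eventually_inf_principal.mpr (by simp)
  filter_upwards [hdisj, (Metric.tendsto_nhds.1 ht) (η / 2) (by positivity)] with E hE hE2
  obtain ⟨n, I⟩ := E
  rw [Real.dist_eq, sub_zero] at hE2 ⊢
  rw [abs_of_nonneg (Finset.sum_nonneg fun _ _ => dist_nonneg)]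
  have hsub : ∀ i ∈ Finset.range n, uIoc (I i).1 (I i).2 ⊆ Ioc a b := fun i hi => by
    have := uIoc_subset_of_mem_disjWithin hE (Finset.mem_range.1 hi)
    rwa [uIoc_of_le hab] at this
  have hmem : ∀ i ∈ Finset.range n, (I i).1 ∈ Icc a b ∧ (I i).2 ∈ Icc a b := fun i hi => by
    have := hE.1 i hi
    rwa [uIcc_of_le hab] at this
  have hlim : Tendsto (fun k => ∑ i ∈ Finset.range n,
      dist (∫ t in a..(I i).1, V k t) (∫ t in a..(I i).2, V k t)) atTop
      (𝓝 (∑ i ∈ Finset.range n, dist (u (I i).1) (u (I i).2))) :=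
    tendsto_finsetSum _ fun i hi => (hu _ (hmem i hi).1).dist (hu _ (hmem i hi).2)
  have key : ∀ k, ∑ i ∈ Finset.range n,
      dist (∫ t in a..(I i).1, V k t) (∫ t in a..(I i).2, V k t) ≤ η / 4 + η / 2 := by
    intro k
    have hW : Integrable (fun x => l * H k x ^ 2 + (1 / (4 * l) + m x)) μ :=
      ((hH' k).const_mul l).add hm2
    have hVW : ∀ᵐ x, x ∈ Ioc a b → |V k x| ≤ l * H k x ^ 2 + (1 / (4 * l) + m x) := by
      filter_upwards [hbd k] with x hx' hx
      have h1 := hx' hx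
      have h2 : |H k x| ≤ l * H k x ^ 2 + 1 / (4 * l) := by
        have : l * H k x ^ 2 + 1 / (4 * l) - |H k x| = (2 * l * |H k x| - 1) ^ 2 / (4 * l) := by
          rw [← sq_abs (H k x)]; field_simp; ring
        have h3 : 0 ≤ (2 * l * |H k x| - 1) ^ 2 / (4 * l) := by positivity
        linarith
      linarith
    have hrestr : ∀ i ∈ Finset.range n, μ.restrict (uIoc (I i).1 (I i).2)
        = volume.restrict (uIoc (I i).1 (I i).2) := fun i hi => by
      rw [hμ, Measure.restrict_restrict measurableSet_uIoc, inter_eq_left.2 (hsub i hi)]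
    calc _ ≤ ∑ i ∈ Finset.range n, ∫ x in uIoc (I i).1 (I i).2,
          (l * H k x ^ 2 + (1 / (4 * l) + m x)) ∂μ := by
          refine Finset.sum_le_sum fun i hi => ?_
          have hii : ∀ y ∈ Icc a b, IntervalIntegrable (V k) volume a y := fun y hy =>
            (hV k).mono_set (by
              rw [uIcc_of_le hab, uIcc_of_le hy.1]; exact Icc_subset_Icc_right hy.2)
          rw [dist_comm, Real.dist_eq, intervalIntegral.integral_interval_sub_left
            (hii _ (hmem i hi).2) (hii _ (hmem i hi).1)]
          refine (intervalIntegral.norm_integral_le_integral_norm_uIoc (f := V k)).trans ?_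
          rw [← hrestr i hi]
          refine setIntegral_mono_on_ae (hV' k).norm.integrableOn hW.integrableOn
            measurableSet_uIoc ?_
          filter_upwards [ae_restrict_of_ae hVW] with x hx hx'
          exact hx (hsub i hi hx')
      _ = ∫ x in s (n, I), (l * H k x ^ 2 + (1 / (4 * l) + m x)) ∂μ := by
          rw [hs]
          rw [integral_biUnion_finset _ (fun i _ => measurableSet_uIoc) hE.2
            (fun i _ => hW.integrableOn)]
      _ = (∫ x in s (n, I), l * H k x ^ 2 ∂μ) + ∫ x in s (n, I), (1 / (4 * l) + m x) ∂μ :=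
          integral_add ((hH' k).const_mul l).integrableOn hm2.integrableOn
      _ ≤ η / 4 + η / 2 := by
          refine add_le_add ?_ ((le_abs_self _).trans hE2.le)
          refine (setIntegral_le_integral ((hH' k).const_mul l)
            (Eventually.of_forall fun x => by positivity)).trans ?_
          rw [integral_const_mul]
          exact (mul_le_mul_of_nonneg_left (hC' k) hl0.le).trans hlC
  have := le_of_tendsto' hlim key
  linarith

open Filter Topology in
theorem tendsto_integral_mul_of_tendsto_integral {a b C : ℝ} (hab : a ≤ b)
    {V : ℕ → ℝ → ℝ} {u g : ℝ → ℝ} (hV : ∀ n, IntervalIntegrable (V n) volume a b)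
    (hC : ∀ n, ∫ x in a..b, |V n x| ≤ C)
    (hac : AbsolutelyContinuousOnInterval u a b)
    (hu : ∀ x ∈ Icc a b, Tendsto (fun n => ∫ t in a..x, V n t) atTop (𝓝 (u x)))
    (hg : ContinuousOn g (Icc a b)) :
    Tendsto (fun n => ∫ x in a..b, g x * V n x) atTop (𝓝 (∫ x in a..b, g x * deriv u x)) := by
  have hu' := hac.intervalIntegrable_deriv
  have hua : u a = 0 := by
    have := hu a (left_mem_Icc.2 hab)
    simp only [intervalIntegral.integral_same] at this
    exact tendsto_nhds_unique this tendsto_const_nhds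
  have hub : ∀ n, ∀ x ∈ Icc a b, |∫ t in a..x, V n t| ≤ C := by
    intro n x hx
    refine (intervalIntegral.abs_integral_le_integral_abs hx.1).trans (le_trans ?_ (hC n))
    refine intervalIntegral.integral_mono_interval le_rfl hx.1 hx.2
      (Eventually.of_forall fun x => abs_nonneg _) (hV n).abs
  have hpoly : ∀ p : Polynomial ℝ, Tendsto (fun n => ∫ x in a..b, p.eval x * V n x) atTop
      (𝓝 (∫ x in a..b, p.eval x * deriv u x)) := by
    intro p
    have hpac : AbsolutelyContinuousOnInterval (fun x => p.eval x) a b := by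
      have h := (p.derivative.continuous.intervalIntegrable (μ := volume) a b)
        |>.absolutelyContinuousOnInterval_intervalIntegral (c := a) (by simp)
      have h2 : (fun x => ∫ v in a..x, p.derivative.eval v) = fun x => p.eval x - p.eval a := by
        ext x
        exact intervalIntegral.integral_eq_sub_of_hasDerivAt (fun y _ => p.hasDerivAt y)
          (p.derivative.continuous.intervalIntegrable _ _)
      rw [h2] at h
      have h3 : AbsolutelyContinuousOnInterval (fun _ => p.eval a) a b := by
        simpa [AbsolutelyContinuousOnInterval] using tendsto_const_nhds
      simpa using h.fun_add h3
    have hd : deriv (fun x => p.eval x) = fun x => p.derivative.eval x := by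
      ext x; exact (p.hasDerivAt x).deriv
    have h1 : ∀ n, ∫ x in a..b, p.eval x * V n x = p.eval b * (∫ t in a..b, V n t) -
        ∫ x in a..b, p.derivative.eval x * ∫ t in a..x, V n t := by
      intro n
      have hvac := (hV n).absolutelyContinuousOnInterval_intervalIntegral (c := a) (by simp)
      have := hpac.integral_mul_deriv_eq_deriv_mul hvac
      rw [hd] at this
      simp only [intervalIntegral.integral_same, mul_zero, sub_zero] at this
      rw [← this]
      apply intervalIntegral.integral_congr_ae
      filter_upwards [(hV n).ae_hasDerivAt_integral] with x hx hx'
      rw [(hx (uIoc_subset_uIcc hx') a (by simp)).deriv]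
    have h2 := hpac.integral_mul_deriv_eq_deriv_mul hac
    rw [hd, hua, mul_zero, sub_zero] at h2
    rw [h2]
    simp_rw [h1]
    refine ((hu b (right_mem_Icc.2 hab)).const_mul _).sub ?_
    refine intervalIntegral.tendsto_integral_filter_of_dominated_convergence
      (fun x => |p.derivative.eval x| * C) ?_ ?_ ?_ ?_
    · refine Eventually.of_forall fun n => ?_
      have hvac := (hV n).absolutelyContinuousOnInterval_intervalIntegral (c := a) (by simp)
      exact ((p.derivative.continuous.continuousOn.mul hvac.continuousOn).mono
        uIoc_subset_uIcc).aestronglyMeasurable measurableSet_uIoc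
    · refine Eventually.of_forall fun n => Eventually.of_forall fun x hx => ?_
      rw [uIoc_of_le hab] at hx
      rw [norm_mul, Real.norm_eq_abs, Real.norm_eq_abs]
      exact mul_le_mul_of_nonneg_left (hub n x (Ioc_subset_Icc_self hx)) (abs_nonneg _)
    · exact (p.derivative.continuous.abs.mul continuous_const).intervalIntegrable _ _
    · refine Eventually.of_forall fun x hx => ?_
      rw [uIoc_of_le hab] at hx
      exact (hu x (Ioc_subset_Icc_self hx)).const_mul _
  have hC0 : 0 ≤ C := le_trans (intervalIntegral.integral_nonneg hab fun _ _ => abs_nonneg _) (hC 0)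
  set D := ∫ x in a..b, |deriv u x| with hD
  have hD0 : 0 ≤ D := intervalIntegral.integral_nonneg hab fun _ _ => abs_nonneg _
  have happrox : ∀ (p : Polynomial ℝ) (δ : ℝ) (w : ℝ → ℝ), IntervalIntegrable w volume a b →
      (∀ x ∈ Icc a b, |p.eval x - g x| < δ) →
      |(∫ x in a..b, p.eval x * w x) - ∫ x in a..b, g x * w x| ≤ δ * ∫ x in a..b, |w x| := by
    intro p δ w hw hp
    rw [← intervalIntegral.integral_sub (hw.continuousOn_mul p.continuous.continuousOn)
      (hw.continuousOn_mul (by rwa [uIcc_of_le hab]))]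
    rw [← intervalIntegral.integral_const_mul]
    refine (intervalIntegral.abs_integral_le_integral_abs hab).trans ?_
    refine intervalIntegral.integral_mono_on hab ?_ (hw.abs.const_mul _) fun x hx => ?_
    · exact ((hw.continuousOn_mul p.continuous.continuousOn).sub
        (hw.continuousOn_mul (by rwa [uIcc_of_le hab]))).abs
    · rw [← sub_mul, abs_mul]
      exact mul_le_mul_of_nonneg_right (hp x hx).le (abs_nonneg _)
  rw [Metric.tendsto_nhds]
  intro η hη
  set δ := η / (3 * (C + D + 1)) with hδ
  have hδ0 : 0 < δ := by positivity
  have hδη : δ * (C + D + 1) = η / 3 := by rw [hδ]; field_simp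
  obtain ⟨p, hp⟩ := exists_polynomial_near_of_continuousOn a b g hg δ hδ0
  filter_upwards [Metric.tendsto_nhds.1 (hpoly p) (η / 3) (by positivity)] with n hn
  rw [Real.dist_eq] at hn ⊢
  have e1 := happrox p δ _ (hV n) hp
  have e2 := happrox p δ _ hu' hp
  have e3 := mul_le_mul_of_nonneg_left (hC n) hδ0.le
  rw [abs_lt] at hn ⊢
  rw [abs_le] at e1 e2
  constructor <;> nlinarith

/-- The conjugate Poisson kernel, up to the factor `1 / π`. -/
noncomputable def conjPoisson (ε y : ℝ) : ℝ := y / (y ^ 2 + ε ^ 2)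

theorem continuous_conjPoisson {ε : ℝ} (hε : 0 < ε) : Continuous (conjPoisson ε) := by
  unfold conjPoisson
  exact continuous_id.div (by fun_prop) fun y => by positivity

open Filter Topology in
theorem tendsto_log_ratio {ε : ℝ} (hε : 0 < ε) (t s : ℝ) {l : Filter ℝ}
    (hl : Tendsto (fun x : ℝ => |x|) l atTop) :
    Tendsto (fun x => Real.log (((x - t) ^ 2 + ε ^ 2) / ((x - s) ^ 2 + ε ^ 2))) l (𝓝 0) := by
  have habs : Tendsto (fun x : ℝ => |x - s|) l atTop := by
    refine tendsto_atTop_mono (fun x => ?_) (tendsto_atTop_add_const_right _ (-|s|) hl)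
    have := abs_sub_abs_le_abs_sub x s
    linarith
  have hinv := habs.inv_tendsto_atTop
  have hbound : Tendsto (fun x => |s - t| * (2 * |x - s|⁻¹ + |s - t| * (|x - s|⁻¹ * |x - s|⁻¹))) l
      (𝓝 0) := by
    have := ((hinv.const_mul 2).add ((hinv.mul hinv).const_mul |s - t|)).const_mul |s - t|
    simpa using this
  have h1 : Tendsto (fun x => ((x - t) ^ 2 + ε ^ 2) / ((x - s) ^ 2 + ε ^ 2) - 1) l (𝓝 0) := by
    refine squeeze_zero_norm' ?_ hbound
    filter_upwards [habs.eventually_gt_atTop 0] with x hx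
    have hD : 0 < (x - s) ^ 2 + ε ^ 2 := by positivity
    have e : ((x - t) ^ 2 + ε ^ 2) / ((x - s) ^ 2 + ε ^ 2) - 1
        = (s - t) * (2 * (x - s) + (s - t)) / ((x - s) ^ 2 + ε ^ 2) := by
      field_simp; ring
    rw [e, Real.norm_eq_abs, abs_div, abs_mul, abs_of_pos hD, mul_div_assoc]
    refine mul_le_mul_of_nonneg_left ?_ (abs_nonneg _)
    have e2 : 2 * |x - s|⁻¹ + |s - t| * (|x - s|⁻¹ * |x - s|⁻¹)
        = (2 * |x - s| + |s - t|) / |x - s| ^ 2 := by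
      field_simp
    rw [e2]
    have e3 : |2 * (x - s) + (s - t)| ≤ 2 * |x - s| + |s - t| := by
      refine (abs_add_le _ _).trans ?_
      rw [abs_mul, abs_two]
    exact div_le_div₀ (by positivity) e3 (by positivity) (by rw [sq_abs]; nlinarith)
  have h2 : Tendsto (fun x => ((x - t) ^ 2 + ε ^ 2) / ((x - s) ^ 2 + ε ^ 2)) l (𝓝 1) := by
    simpa using h1.add_const 1
  rw [← Real.log_one]
  exact (Real.continuousAt_log one_ne_zero).tendsto.comp h2

theorem exists_abs_conjPoisson_mul_le {ε : ℝ} (hε : 0 < ε) (a b : ℝ) :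
    ∃ K, ∀ t ∈ Icc a b, ∀ s ∈ Icc a b, ∀ x,
      |conjPoisson ε (t - x) * conjPoisson ε (s - x)| ≤ K * (1 + x ^ 2)⁻¹ := by
  set B := |a| + |b| with hB
  set K := 2 + (1 + 2 * B ^ 2) / ε ^ 2 with hK
  have hK0 : 0 < K := by positivity
  have key : ∀ t ∈ Icc a b, ∀ x, conjPoisson ε (t - x) ^ 2 ≤ K * (1 + x ^ 2)⁻¹ := by
    intro t ht x
    have htB : t ^ 2 ≤ B ^ 2 := by
      rw [← sq_abs t]
      have : |t| ≤ B := by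
        rw [abs_le]
        constructor
        · linarith [ht.1, neg_abs_le a, abs_nonneg b]
        · linarith [ht.2, le_abs_self b, abs_nonneg a]
      exact pow_le_pow_left₀ (abs_nonneg _) this 2
    have h1 : 1 + x ^ 2 ≤ K * ((t - x) ^ 2 + ε ^ 2) := by
      have e : K * ((t - x) ^ 2 + ε ^ 2) = 2 * (t - x) ^ 2 + 2 * ε ^ 2 + 1 + 2 * B ^ 2
          + (1 + 2 * B ^ 2) / ε ^ 2 * (t - x) ^ 2 := by
        rw [hK]; field_simp; ring
      have : 0 ≤ (1 + 2 * B ^ 2) / ε ^ 2 * (t - x) ^ 2 := by positivity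
      nlinarith [sq_nonneg (x - 2 * t), sq_nonneg ε]
    have h2 : conjPoisson ε (t - x) ^ 2 ≤ ((t - x) ^ 2 + ε ^ 2)⁻¹ := by
      unfold conjPoisson
      rw [div_pow, inv_eq_one_div, div_le_div_iff₀ (by positivity) (by positivity)]
      nlinarith [sq_nonneg (t - x), sq_nonneg ε, mul_nonneg (sq_nonneg (t-x)) (sq_nonneg ε),
        sq_nonneg (ε ^ 2)]
    refine h2.trans ?_
    rw [← div_eq_mul_inv, inv_eq_one_div, div_le_div_iff₀ (by positivity) (by positivity)]
    linarith
  refine ⟨K, fun t ht s hs x => ?_⟩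
  have h1 := key t ht x
  have h2 := key s hs x
  rw [abs_le]
  constructor
  · nlinarith [sq_nonneg (conjPoisson ε (t - x) + conjPoisson ε (s - x))]
  · nlinarith [sq_nonneg (conjPoisson ε (t - x) - conjPoisson ε (s - x))]

theorem integrable_conjPoisson_mul {ε : ℝ} (hε : 0 < ε) (t s : ℝ) :
    Integrable fun x => conjPoisson ε (t - x) * conjPoisson ε (s - x) := by
  obtain ⟨K, hK⟩ := exists_abs_conjPoisson_mul_le hε (min t s) (max t s)
  refine (integrable_inv_one_add_sq.const_mul K).mono' ?_ ?_
  · have := continuous_conjPoisson hε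
    exact Continuous.aestronglyMeasurable (by fun_prop)
  · exact Filter.Eventually.of_forall fun x => hK t (by simp) s (by simp) x

open Filter Topology in
theorem integral_conjPoisson_mul {ε : ℝ} (hε : 0 < ε) {t s : ℝ} (hts : t ≠ s) :
    ∫ x, conjPoisson ε (t - x) * conjPoisson ε (s - x)
      = 2 * Real.pi * ε / ((s - t) ^ 2 + 4 * ε ^ 2) := by
  have hd : s - t ≠ 0 := sub_ne_zero.2 hts.symm
  set D := (s - t) ^ 2 + 4 * ε ^ 2 with hD
  have hD0 : 0 < D := by positivity
  set A := -((s - t) ^ 2 + 2 * ε ^ 2) / ((s - t) * D) with hA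
  set B := ε ^ 2 / D with hB
  set P : ℝ → ℝ := fun x => A / 2 * Real.log (((x - t) ^ 2 + ε ^ 2) / ((x - s) ^ 2 + ε ^ 2))
    + B / ε * (Real.arctan ((x - t) / ε) + Real.arctan ((x - s) / ε)) with hP
  have hderiv : ∀ x, HasDerivAt P (conjPoisson ε (t - x) * conjPoisson ε (s - x)) x := by
    intro x
    have p1 : 0 < (x - t) ^ 2 + ε ^ 2 := by positivity
    have p2 : 0 < (x - s) ^ 2 + ε ^ 2 := by positivity
    have q1 : ∀ r : ℝ, HasDerivAt (fun x => (x - r) ^ 2 + ε ^ 2) (2 * (x - r)) x := fun r => by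
      simpa using (((hasDerivAt_id x).sub_const r).pow 2).add_const (ε ^ 2)
    have q2 : ∀ r : ℝ, HasDerivAt (fun x => Real.arctan ((x - r) / ε))
        (1 / (1 + ((x - r) / ε) ^ 2) * (1 / ε)) x := fun r =>
      (((hasDerivAt_id x).sub_const r).div_const ε).arctan
    have := ((((q1 t).div (q1 s) p2.ne').log (div_pos p1 p2).ne').const_mul (A / 2)).add
      (((q2 t).add (q2 s)).const_mul (B / ε))
    refine this.congr_deriv ?_
    have r1 : ∀ r : ℝ, 1 / (1 + ((x - r) / ε) ^ 2) * (1 / ε)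
        = ε / ((x - r) ^ 2 + ε ^ 2) := fun r => by
      have : 0 < (x - r) ^ 2 + ε ^ 2 := by positivity
      field_simp
      ring
    rw [r1, r1, hA, hB]
    unfold conjPoisson
    have e1 : (t - x) ^ 2 = (x - t) ^ 2 := by ring
    have e2 : (s - x) ^ 2 = (x - s) ^ 2 := by ring
    rw [e1, e2]
    simp only [Pi.div_apply]
    field_simp
    rw [hD]
    ring
  have harc : ∀ r : ℝ, Tendsto (fun x => Real.arctan ((x - r) / ε)) atTop (𝓝 (Real.pi / 2)) :=
    fun r => (tendsto_nhds_of_tendsto_nhdsWithin Real.tendsto_arctan_atTop).comp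
      ((tendsto_atTop_add_const_right _ (-r) tendsto_id).atTop_div_const hε)
  have harc' : ∀ r : ℝ, Tendsto (fun x => Real.arctan ((x - r) / ε)) atBot (𝓝 (-(Real.pi / 2))) :=
    fun r => (tendsto_nhds_of_tendsto_nhdsWithin Real.tendsto_arctan_atBot).comp
      ((tendsto_atBot_add_const_right _ (-r) tendsto_id).atBot_div_const hε)
  have htop : Tendsto P atTop (𝓝 (A / 2 * 0 + B / ε * (Real.pi / 2 + Real.pi / 2))) :=
    ((tendsto_log_ratio hε t s tendsto_abs_atTop_atTop).const_mul _).add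
      (((harc t).add (harc s)).const_mul _)
  have hbot : Tendsto P atBot (𝓝 (A / 2 * 0 + B / ε * (-(Real.pi / 2) + -(Real.pi / 2)))) :=
    ((tendsto_log_ratio hε t s tendsto_abs_atBot_atTop).const_mul _).add
      (((harc' t).add (harc' s)).const_mul _)
  rw [integral_of_hasDerivAt_of_tendsto hderiv (integrable_conjPoisson_mul hε t s) hbot htop, hB]
  field_simp
  ring

theorem integral_inv_sub_sq_add_sq {δ : ℝ} (hδ : 0 < δ) (t : ℝ) :
    Integrable (fun s : ℝ => ((s - t) ^ 2 + δ ^ 2)⁻¹) ∧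
      ∫ s : ℝ, ((s - t) ^ 2 + δ ^ 2)⁻¹ = Real.pi / δ := by
  have e : (fun s : ℝ => (s ^ 2 + δ ^ 2)⁻¹) = fun s => (δ ^ 2)⁻¹ * (1 + (δ⁻¹ * s) ^ 2)⁻¹ := by
    ext s
    field_simp
    ring
  have h1 : Integrable (fun s : ℝ => (s ^ 2 + δ ^ 2)⁻¹) := by
    rw [e]
    exact (integrable_inv_one_add_sq.comp_mul_left' (inv_ne_zero hδ.ne')).const_mul _
  refine ⟨h1.comp_sub_right t, ?_⟩
  rw [integral_sub_right_eq_self (fun s : ℝ => (s ^ 2 + δ ^ 2)⁻¹) t, e, integral_const_mul,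
    Measure.integral_comp_mul_left (fun s => (1 + s ^ 2)⁻¹), integral_univ_inv_one_add_sq]
  rw [inv_inv, abs_of_pos hδ, smul_eq_mul]
  field_simp

open Filter in
/-- The conjugate Poisson kernels act on bounded functions supported in an interval as a family
of uniformly `L²`-bounded operators. -/
theorem integral_conjPoisson_convolution_sq_le {a b M ε : ℝ} (hab : a ≤ b) (hε : 0 < ε)
    {φ : ℝ → ℝ} (hφ : AEStronglyMeasurable φ (volume.restrict (Ioc a b)))
    (hM : ∀ t ∈ Ioc a b, |φ t| ≤ M) :
    IntervalIntegrable (fun x => (∫ t in a..b, φ t * conjPoisson ε (t - x)) ^ 2) volume a b ∧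
    ∫ x in a..b, (∫ t in a..b, φ t * conjPoisson ε (t - x)) ^ 2
      ≤ M ^ 2 * Real.pi ^ 2 * (b - a) := by
  set μ := volume.restrict (Ioc a b) with hμ
  obtain ⟨K, hK⟩ := exists_abs_conjPoisson_mul_le hε a b
  have hc := continuous_conjPoisson hε
  have hMae : ∀ᵐ t ∂μ, t ∈ Ioc a b := ae_restrict_mem measurableSet_Ioc
  have hmemprod : ∀ᵐ p ∂(μ.prod μ), p.1 ∈ Ioc a b ∧ p.2 ∈ Ioc a b := by
    rw [hμ, Measure.prod_restrict]
    exact ae_restrict_mem (measurableSet_Ioc.prod measurableSet_Ioc)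
  set F : ℝ → ℝ × ℝ → ℝ := fun x p =>
    (φ p.1 * conjPoisson ε (p.1 - x)) * (φ p.2 * conjPoisson ε (p.2 - x)) with hF
  have hFle : ∀ x, ∀ p : ℝ × ℝ, p.1 ∈ Ioc a b ∧ p.2 ∈ Ioc a b →
      |F x p| ≤ M ^ 2 * |conjPoisson ε (p.1 - x) * conjPoisson ε (p.2 - x)| := by
    intro x p hp
    have : F x p = (φ p.1 * φ p.2) * (conjPoisson ε (p.1 - x) * conjPoisson ε (p.2 - x)) := by
      simp only [hF]; ring
    rw [this, abs_mul, abs_mul (φ p.1), sq]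
    have h1 := hM _ hp.1
    exact mul_le_mul_of_nonneg_right (mul_le_mul h1 (hM _ hp.2) (abs_nonneg _)
      ((abs_nonneg _).trans h1)) (abs_nonneg _)
  have hFint : Integrable (Function.uncurry F) (volume.prod (μ.prod μ)) := by
    have hdom : Integrable (fun z : ℝ × (ℝ × ℝ) => (1 + z.1 ^ 2)⁻¹ * (M ^ 2 * K))
        (volume.prod (μ.prod μ)) :=
      integrable_inv_one_add_sq.mul_prod (integrable_const (M ^ 2 * K))
    refine hdom.mono' ?_ ?_
    · have c1 : AEStronglyMeasurable (fun z : ℝ × (ℝ × ℝ) => φ z.2.1) (volume.prod (μ.prod μ)) :=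
        hφ.comp_fst.comp_snd
      have c2 : AEStronglyMeasurable (fun z : ℝ × (ℝ × ℝ) => φ z.2.2) (volume.prod (μ.prod μ)) :=
        (hφ.comp_snd (μ := μ)).comp_snd
      have d1 : Continuous fun z : ℝ × (ℝ × ℝ) => conjPoisson ε (z.2.1 - z.1) := by fun_prop
      have d2 : Continuous fun z : ℝ × (ℝ × ℝ) => conjPoisson ε (z.2.2 - z.1) := by fun_prop
      exact (c1.mul d1.aestronglyMeasurable).mul (c2.mul d2.aestronglyMeasurable)
    · have : ∀ᵐ z : ℝ × (ℝ × ℝ) ∂(volume.prod (μ.prod μ)), z.2.1 ∈ Ioc a b ∧ z.2.2 ∈ Ioc a b :=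
        Measure.quasiMeasurePreserving_snd.ae hmemprod
      filter_upwards [this] with z hz
      refine (hFle z.1 z.2 hz).trans ?_
      have := hK _ (Ioc_subset_Icc_self hz.1) _ (Ioc_subset_Icc_self hz.2) z.1
      have h2 := mul_le_mul_of_nonneg_left this (sq_nonneg M)
      linarith
  have hH : ∀ x, (∫ t in a..b, φ t * conjPoisson ε (t - x)) ^ 2 = ∫ p, F x p ∂(μ.prod μ) := by
    intro x
    rw [intervalIntegral.integral_of_le hab, sq]
    exact (integral_prod_mul (μ := μ) (ν := μ) (fun t => φ t * conjPoisson ε (t - x))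
      (fun t => φ t * conjPoisson ε (t - x))).symm
  have hHint : Integrable (fun x => (∫ t in a..b, φ t * conjPoisson ε (t - x)) ^ 2) := by
    simp_rw [hH]
    exact hFint.integral_prod_left
  refine ⟨hHint.intervalIntegrable, ?_⟩
  have hk : ∀ t s : ℝ, 2 * Real.pi * ε / ((s - t) ^ 2 + 4 * ε ^ 2)
      = 2 * Real.pi * ε * ((s - t) ^ 2 + (2 * ε) ^ 2)⁻¹ := fun t s => by
    rw [div_eq_mul_inv]; ring_nf
  have hinner : ∀ t s, t ∈ Ioc a b → s ∈ Ioc a b → t ≠ s →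
      ‖∫ x, F x (t, s)‖ ≤ M ^ 2 * (2 * Real.pi * ε * ((s - t) ^ 2 + (2 * ε) ^ 2)⁻¹) := by
    intro t s ht hs hts
    have : (fun x => F x (t, s)) = fun x =>
        (φ t * φ s) * (conjPoisson ε (t - x) * conjPoisson ε (s - x)) := by
      ext x; simp only [hF]; ring
    rw [this, integral_const_mul, integral_conjPoisson_mul hε hts, hk, norm_mul]
    have h1 := hM _ ht
    have h2 : 0 < (s - t) ^ 2 + (2 * ε) ^ 2 := by positivity
    have h3 : 0 ≤ 2 * Real.pi * ε * ((s - t) ^ 2 + (2 * ε) ^ 2)⁻¹ := by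
      have := Real.pi_pos; positivity
    rw [Real.norm_eq_abs, Real.norm_eq_abs, abs_mul, abs_of_nonneg h3, sq M]
    exact mul_le_mul_of_nonneg_right (mul_le_mul h1 (hM _ hs) (abs_nonneg _)
      ((abs_nonneg _).trans h1)) h3
  have hmid : ∀ t ∈ Ioc a b, ‖∫ s, (∫ x, F x (t, s)) ∂μ‖ ≤ M ^ 2 * Real.pi ^ 2 := by
    intro t ht
    obtain ⟨i1, i2⟩ := integral_inv_sub_sq_add_sq (δ := 2 * ε) (by positivity) t
    have hi : Integrable (fun s : ℝ => M ^ 2 * (2 * Real.pi * ε * ((s - t) ^ 2 + (2 * ε) ^ 2)⁻¹)) :=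
      (i1.const_mul _).const_mul _
    have hne : ∀ᵐ s ∂μ, t ≠ s := by
      refine ae_restrict_of_ae ?_
      filter_upwards [(measure_eq_zero_iff_ae_notMem.1 (measure_singleton t))] with s hs h
      exact hs h.symm
    have h1 := norm_integral_le_of_norm_le (f := fun s => ∫ x, F x (t, s)) (μ := μ)
      (hi.mono_measure Measure.restrict_le_self) (by
      filter_upwards [hne, hMae] with s hs hs'
      exact hinner t s ht hs' hs)
    refine h1.trans ((setIntegral_le_integral hi (Eventually.of_forall fun s => ?_)).trans ?_)
    · have := Real.pi_pos
      simp only [Pi.zero_apply]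
      positivity
    · rw [integral_const_mul, integral_const_mul, i2]
      apply le_of_eq; field_simp
  have hswap : ∫ x, (∫ t in a..b, φ t * conjPoisson ε (t - x)) ^ 2
      = ∫ t, (∫ s, (∫ x, F x (t, s)) ∂μ) ∂μ := by
    simp_rw [hH]
    rw [integral_integral_swap hFint]
    exact integral_prod _ hFint.integral_prod_right
  rw [intervalIntegral.integral_of_le hab]
  refine (setIntegral_le_integral hHint (Eventually.of_forall fun x => sq_nonneg _)).trans ?_
  rw [hswap]
  refine (le_abs_self _).trans ?_
  have h2 := norm_integral_le_of_norm_le (f := fun t => ∫ s, (∫ x, F x (t, s)) ∂μ) (μ := μ)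
    (integrable_const (M ^ 2 * Real.pi ^ 2)) (by filter_upwards [hMae] with t ht using hmid t ht)
  refine h2.trans (le_of_eq ?_)
  rw [integral_const, hμ]
  simp [Measure.real, hab]
  ring

theorem abs_rpow_sub_rpow_le {p x y : ℝ} (hp0 : 0 ≤ p) (hp1 : p ≤ 1) (hx : 0 ≤ x) (hy : 0 ≤ y) :
    |x ^ p - y ^ p| ≤ |x - y| ^ p := by
  wlog h : y ≤ x generalizing x y
  · rw [abs_sub_comm, abs_sub_comm x]; exact this hy hx (le_of_not_ge h)
  have h1 := Real.rpow_le_rpow hy h hp0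
  rw [abs_of_nonneg (by linarith), abs_of_nonneg (by linarith)]
  have := Real.rpow_add_le_add_rpow (sub_nonneg.2 h) hy hp0 hp1
  rw [sub_add_cancel] at this
  linarith

theorem intervalIntegrable_sub_rpow_mul {α : ℝ} (hα0 : 0 < α) {a c t : ℝ} {w : ℝ → ℝ}
    (hw : ContinuousOn w (uIcc a c)) :
    IntervalIntegrable (fun s => w s * (t - s) ^ (α - 1)) volume a c := by
  have h := (intervalIntegral.intervalIntegrable_rpow' (a := t - a) (b := t - c)
    (r := α - 1) (by linarith)).comp_sub_left t
  simp only [sub_sub_cancel] at h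
  exact h.continuousOn_mul hw

theorem integral_rpow_mul_rpow_shift {α : ℝ} (hα0 : 0 < α) {a c t X : ℝ}
    (hac : a ≤ c) (hct : c ≤ t) (hcX : c < X) (htX : t ≠ X) :
    α * ∫ s in a..c, (X - s) ^ (-α - 1) * (t - s) ^ (α - 1)
      = (((t - c) / (X - c)) ^ α - ((t - a) / (X - a)) ^ α) / (t - X) := by
  have hX : ∀ s ∈ Icc a c, 0 < X - s := fun s hs => by linarith [hs.2]
  have htX' : t - X ≠ 0 := sub_ne_zero.2 htX
  rw [eq_div_iff htX', mul_right_comm, mul_comm (α * (t - X)),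
    ← intervalIntegral.integral_mul_const]
  have hint : IntervalIntegrable
      (fun s => (X - s) ^ (-α - 1) * (t - s) ^ (α - 1) * (α * (t - X))) volume a c := by
    refine (intervalIntegrable_sub_rpow_mul hα0 ?_).mul_const _
    rw [uIcc_of_le hac]
    exact ContinuousOn.rpow_const (by fun_prop) fun s hs => Or.inl (hX s hs).ne'
  refine intervalIntegral.integral_eq_sub_of_hasDerivAt_of_le
    (f := fun s => ((t - s) / (X - s)) ^ α) hac ?_ ?_ hint
  · refine ContinuousOn.rpow_const ?_ fun s hs => Or.inr hα0.le
    exact ContinuousOn.div (by fun_prop) (by fun_prop) fun s hs => (hX s hs).ne'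
  · intro s hs
    have p1 : 0 < X - s := hX s (Ioo_subset_Icc_self hs)
    have p2 : 0 < t - s := by linarith [hs.2]
    have d := (((hasDerivAt_id s).const_sub t).div ((hasDerivAt_id s).const_sub X)
      p1.ne').rpow_const
      (p := α) (Or.inl (div_pos p2 p1).ne')
    refine d.congr_deriv ?_
    simp only [id, Pi.div_apply]
    rw [Real.div_rpow p2.le p1.le, Real.rpow_sub p1 (-α) 1, Real.rpow_neg p1.le,
      Real.rpow_sub p1, Real.rpow_one]
    have := (Real.rpow_pos_of_pos p1 α).ne'
    field_simp
    ring

/-- The kernel of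
`φ ↦ d/dx ∫ s in a..x, (x - s + ε) ^ (-α) * ∫ t in s..b, (t - s) ^ (α - 1) * φ t`. -/
noncomputable def shiftedKernel (a α ε x t : ℝ) : ℝ :=
  (if x < t then ε ^ (-α) * (t - x) ^ (α - 1) else 0)
    - α * ∫ s in a..(min t x), (x + ε - s) ^ (-α - 1) * (t - s) ^ (α - 1)

/-- An integrable majorant for the difference between the profile of `shiftedKernel` and the
conjugate Poisson kernel. -/
noncomputable def profileMajorant (α z : ℝ) : ℝ :=
  (1 + z ^ 2)⁻¹ + ((Ioc 0 1).indicator (fun z => 2 * z ^ (α - 1)) z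
    + (Ioi 1).indicator (fun z => 2 * z ^ (α - 2)) z)

theorem integrable_profileMajorant {α : ℝ} (hα0 : 0 < α) (hα1 : α < 1) :
    Integrable (profileMajorant α) := by
  refine integrable_inv_one_add_sq.add (Integrable.add ?_ ?_)
  · rw [integrable_indicator_iff measurableSet_Ioc]
    have := (intervalIntegral.intervalIntegrable_rpow' (a := 0) (b := 1)
      (r := α - 1) (by linarith)).const_mul 2
    exact (intervalIntegrable_iff_integrableOn_Ioc_of_le zero_le_one).1 this
  · rw [integrable_indicator_iff measurableSet_Ioi]
    exact (integrableOn_Ioi_rpow_of_lt (by linarith) zero_lt_one).const_mul 2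

theorem abs_profile_sub_le_of_pos {α z : ℝ} (hα0 : 0 < α) (hα1 : α < 1) (hz : 0 < z) (hz1 : z ≠ 1) :
    |z ^ (α - 1) - (z ^ α - 1) / (z - 1) - z / (z ^ 2 + 1)| ≤ profileMajorant α z := by
  have hz1' : z - 1 ≠ 0 := sub_ne_zero.2 hz1
  have hzα : z ^ α = z * z ^ (α - 1) := by
    rw [Real.rpow_sub_one hz.ne']; field_simp
  set w := z ^ (α - 1) with hw
  have hw0 : 0 < w := Real.rpow_pos_of_pos hz _
  have e : w - (z ^ α - 1) / (z - 1) = (1 - w) / (z - 1) := by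
    rw [hzα]; field_simp; ring
  rw [e]
  unfold profileMajorant
  have hinv : 0 < (1 + z ^ 2)⁻¹ := by positivity
  rcases lt_or_gt_of_ne hz1 with h | h
  · have m1 : z ∈ Ioc (0 : ℝ) 1 := ⟨hz, h.le⟩
    have m2 : z ∉ Ioi (1 : ℝ) := by simp [h.le]
    rw [indicator_of_mem m1, indicator_of_notMem m2]
    have w1 : 1 ≤ w := by
      rw [hw]; exact Real.one_le_rpow_of_pos_of_le_one_of_nonpos hz h.le (by linarith)
    have zw : z * w ≤ 1 := by rw [← hzα]; exact Real.rpow_le_one hz.le h.le hα0.le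
    have b1 : 0 ≤ (1 - w) / (z - 1) := div_nonneg_of_nonpos (by linarith) (by linarith)
    have b2 : (1 - w) / (z - 1) ≤ w := by
      rw [div_le_iff_of_neg (by linarith)]; nlinarith
    have b3 : 0 ≤ z / (z ^ 2 + 1) := by positivity
    have b4 : z / (z ^ 2 + 1) ≤ 1 := by
      rw [div_le_one (by positivity)]; nlinarith
    rw [abs_le]
    constructor <;> linarith
  · have hz' : 1 < z := h
    have m1 : z ∉ Ioc (0 : ℝ) 1 := by simp [hz']
    have m2 : z ∈ Ioi (1 : ℝ) := h
    rw [indicator_of_notMem m1, indicator_of_mem m2]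
    have w1 : w ≤ 1 := by rw [hw]; exact Real.rpow_le_one_of_one_le_of_nonpos hz'.le (by linarith)
    have zw : 1 ≤ z * w := by rw [← hzα]; exact Real.one_le_rpow hz'.le hα0.le
    have hw2 : z ^ (α - 2) = w / z := by
      rw [hw, ← Real.rpow_sub_one hz.ne']; ring_nf
    rw [hw2]
    have b1 : (1 - w) / (z - 1) = 1 / z - (z * w - 1) / (z * (z - 1)) := by
      field_simp; ring
    have b2 : 0 ≤ (z * w - 1) / (z * (z - 1)) :=
      div_nonneg (by linarith) (mul_nonneg hz.le (by linarith))
    have b3 : (z * w - 1) / (z * (z - 1)) ≤ w / z := by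
      rw [div_le_div_iff₀ (mul_pos hz (by linarith)) hz]
      nlinarith [mul_nonneg hz.le (sub_nonneg.2 w1)]
    have b4 : 1 / z - z / (z ^ 2 + 1) = 1 / (z * (z ^ 2 + 1)) := by
      field_simp; ring
    have b5 : 1 / (z * (z ^ 2 + 1)) ≤ (1 + z ^ 2)⁻¹ := by
      rw [inv_eq_one_div]
      exact one_div_le_one_div_of_le (by positivity) (by nlinarith [sq_nonneg z])
    have b6 : 0 ≤ 1 / (z * (z ^ 2 + 1)) := by positivity
    have b7 : 0 ≤ w / z := by positivity
    rw [b1, abs_le]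
    constructor <;> linarith

theorem abs_profile_sub_le_of_neg {α z : ℝ} (hz : z < 0) :
    |1 / (z - 1) - z / (z ^ 2 + 1)| ≤ profileMajorant α z := by
  have m1 : z ∉ Ioc (0 : ℝ) 1 := by simp [hz.le]
  have m2 : z ∉ Ioi (1 : ℝ) := by simp; linarith
  unfold profileMajorant
  rw [indicator_of_notMem m1, indicator_of_notMem m2, add_zero, add_zero]
  have hz1 : 0 < 1 - z := by linarith
  have e : 1 / (z - 1) - z / (z ^ 2 + 1) = -((1 + z) / (1 - z)) * (1 + z ^ 2)⁻¹ := by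
    have : z - 1 ≠ 0 := by linarith
    field_simp
    ring
  rw [e, abs_mul, abs_of_pos (a := (1 + z ^ 2)⁻¹) (by positivity), abs_neg]
  refine mul_le_of_le_one_left (by positivity) ?_
  rw [abs_div, abs_of_pos hz1, div_le_one hz1, abs_le]
  constructor <;> linarith

theorem abs_shiftedKernel_sub_conjPoisson_le {a α ε x t : ℝ} (hα0 : 0 < α) (hα1 : α < 1)
    (hε : 0 < ε) (hx : a < x) (ht : a < t) (htx : t ≠ x) (htxε : t ≠ x + ε) :
    |shiftedKernel a α ε x t - conjPoisson ε (t - x)| ≤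
      ε⁻¹ * profileMajorant α ((t - x) / ε) + (x - a) ^ (-α) * |t - (x + ε)| ^ (α - 1) := by
  have hy : t - (x + ε) ≠ 0 := sub_ne_zero.2 htxε
  have hX : 0 < x + ε - a := by linarith
  have hT : 0 < t - a := by linarith
  set R := ((t - a) / (x + ε - a)) ^ α with hR
  have hQ : conjPoisson ε (t - x) = ε⁻¹ * (((t - x) / ε) / (((t - x) / ε) ^ 2 + 1)) := by
    unfold conjPoisson
    have : 0 < (t - x) ^ 2 + ε ^ 2 := by positivity
    field_simp
  have hbdry : |(R - 1) / (t - (x + ε))| ≤ (x - a) ^ (-α) * |t - (x + ε)| ^ (α - 1) := by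
    have e : R - 1 = ((t - a) ^ α - (x + ε - a) ^ α) * (x + ε - a) ^ (-α) := by
      have := (Real.rpow_pos_of_pos hX α).ne'
      rw [hR, Real.div_rpow hT.le hX.le, Real.rpow_neg hX.le]; field_simp
    have h1 := abs_rpow_sub_rpow_le hα0.le hα1.le hT.le hX.le
    have h2 : (x + ε - a) ^ (-α) ≤ (x - a) ^ (-α) :=
      Real.rpow_le_rpow_of_nonpos (by linarith) (by linarith) (by linarith)
    have h3 : t - a - (x + ε - a) = t - (x + ε) := by ring
    rw [h3] at h1
    have hy' : 0 < |t - (x + ε)| := abs_pos.2 hy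
    rw [e, abs_div, abs_mul, abs_of_pos (Real.rpow_pos_of_pos hX _), Real.rpow_sub_one hy'.ne',
      ← mul_div_assoc]
    refine div_le_div_of_nonneg_right ?_ hy'.le
    rw [mul_comm]
    exact mul_le_mul h2 h1 (abs_nonneg _) (Real.rpow_nonneg (by linarith) _)
  suffices h : ∃ P, shiftedKernel a α ε x t = ε⁻¹ * P + (R - 1) / (t - (x + ε)) ∧
      |P - ((t - x) / ε) / (((t - x) / ε) ^ 2 + 1)| ≤ profileMajorant α ((t - x) / ε) by
    obtain ⟨P, h1, h2⟩ := h
    have : shiftedKernel a α ε x t - conjPoisson ε (t - x)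
        = ε⁻¹ * (P - ((t - x) / ε) / (((t - x) / ε) ^ 2 + 1)) + (R - 1) / (t - (x + ε)) := by
      rw [h1, hQ]; ring
    rw [this]
    refine (abs_add_le _ _).trans (add_le_add ?_ hbdry)
    rw [abs_mul, abs_of_pos (inv_pos.2 hε)]
    exact mul_le_mul_of_nonneg_left h2 (inv_pos.2 hε).le
  have hzε : (t - x) / ε - 1 = (t - (x + ε)) / ε := by field_simp; ring
  rcases lt_or_gt_of_ne htx with h | h
  · refine ⟨1 / ((t - x) / ε - 1), ?_,
      abs_profile_sub_le_of_neg (div_neg_of_neg_of_pos (by linarith) hε)⟩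
    unfold shiftedKernel
    rw [if_neg h.not_gt, min_eq_left h.le, integral_rpow_mul_rpow_shift hα0 ht.le le_rfl
      (by linarith) htxε, sub_self, zero_div, Real.zero_rpow hα0.ne', hzε, ← hR]
    field_simp
    ring
  · have hz : 0 < (t - x) / ε := div_pos (by linarith) hε
    refine ⟨((t - x) / ε) ^ (α - 1) - (((t - x) / ε) ^ α - 1) / ((t - x) / ε - 1), ?_,
      abs_profile_sub_le_of_pos hα0 hα1 hz ?_⟩
    · unfold shiftedKernel
      rw [if_pos h, min_eq_right h.le, integral_rpow_mul_rpow_shift hα0 hx.le h.le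
        (by linarith) htxε, hzε, ← hR]
      have e1 : ε⁻¹ * ((t - x) / ε) ^ (α - 1) = ε ^ (-α) * (t - x) ^ (α - 1) := by
        have := (Real.rpow_pos_of_pos hε α).ne'
        rw [Real.div_rpow (by linarith) hε.le, Real.rpow_sub_one hε.ne', Real.rpow_neg hε.le]
        field_simp
      have e2 : x + ε - x = ε := by ring
      rw [e2, mul_sub, e1]
      field_simp
      ring
    · intro h1
      rw [div_eq_one_iff_eq hε.ne'] at h1
      exact htxε (by linarith)

theorem triangle_convolution {a b C : ℝ} (hab : a ≤ b) {k A B : ℝ → ℝ}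
    (hk : IntervalIntegrable k volume 0 (b - a))
    (hA : AEStronglyMeasurable A (volume.restrict (Ioc a b)))
    (hC : ∀ t ∈ Ioc a b, |A t| ≤ C) (hB : IntervalIntegrable B volume a b) :
    IntervalIntegrable (fun s => A s * ∫ t in s..b, k (t - s) * B t) volume a b ∧
    IntervalIntegrable (fun t => B t * ∫ s in a..t, k (t - s) * A s) volume a b ∧
    ∫ t in a..b, B t * (∫ s in a..t, k (t - s) * A s)
      = ∫ s in a..b, A s * ∫ t in s..b, k (t - s) * B t := by
  set K := (Ioc 0 (b - a)).indicator k with hKdef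
  set A' := (Ioc a b).indicator A with hA'
  set B' := (Ioc a b).indicator B with hB'
  have hK : Integrable K := by
    rw [integrable_indicator_iff measurableSet_Ioc]
    exact (intervalIntegrable_iff_integrableOn_Ioc_of_le (by linarith)).1 hk
  have hBi : Integrable B' := by
    rw [integrable_indicator_iff measurableSet_Ioc]
    exact (intervalIntegrable_iff_integrableOn_Ioc_of_le hab).1 hB
  have hAm : AEStronglyMeasurable A' :=
    (aestronglyMeasurable_indicator_iff measurableSet_Ioc).2 hA
  have hAb : ∀ t, ‖A' t‖ ≤ |C| := fun t => by
    by_cases h : t ∈ Ioc a b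
    · simp only [hA', indicator_of_mem h, Real.norm_eq_abs]
      exact (hC t h).trans (le_abs_self C)
    · simp [hA', indicator_of_notMem h]
  have hconv := hBi.convolution_integrand (ContinuousLinearMap.mul ℝ ℝ) hK.comp_neg
  have hF : Integrable (fun p : ℝ × ℝ => A' p.1 * (K (p.2 - p.1) * B' p.2))
      (volume.prod volume) := by
    have := hconv.bdd_mul (f := fun p : ℝ × ℝ => A' p.1) (c := |C|) hAm.comp_fst
      (.of_forall fun p => hAb p.1)
    refine this.congr (.of_forall fun p => ?_)
    simp only [ContinuousLinearMap.mul_apply', neg_sub]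
    ring
  have inner1 : ∀ s, ∫ t, A' s * (K (t - s) * B' t)
      = (Ioc a b).indicator (fun s => A s * ∫ t in s..b, k (t - s) * B t) s := fun s => by
    rw [integral_const_mul]
    by_cases hs : s ∈ Ioc a b
    · simp only [hA', indicator_of_mem hs]
      rw [intervalIntegral.integral_of_le hs.2, ← integral_indicator measurableSet_Ioc]
      congr 2
      ext t
      by_cases ht : t ∈ Ioc s b
      · have h1 : t - s ∈ Ioc 0 (b - a) := ⟨by linarith [ht.1], by linarith [ht.2, hs.1]⟩
        have h2 : t ∈ Ioc a b := ⟨by linarith [ht.1, hs.1], ht.2⟩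
        simp only [hKdef, hB', indicator_of_mem ht, indicator_of_mem h1, indicator_of_mem h2]
      · rw [indicator_of_notMem ht]
        rcases lt_or_ge s t with h | h
        · have h2 : t ∉ Ioc a b := fun h2 => ht ⟨h, h2.2⟩
          simp [hB', indicator_of_notMem h2]
        · have h1 : t - s ∉ Ioc 0 (b - a) := fun h1 => by linarith [h1.1]
          simp [hKdef, indicator_of_notMem h1]
    · simp [hA', indicator_of_notMem hs]
  have inner2 : ∀ t, ∫ s, A' s * (K (t - s) * B' t)
      = (Ioc a b).indicator (fun t => B t * ∫ s in a..t, k (t - s) * A s) t := fun t => by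
    have : ∀ s, A' s * (K (t - s) * B' t) = B' t * (K (t - s) * A' s) := fun s => by ring
    simp only [this]
    rw [integral_const_mul]
    by_cases ht : t ∈ Ioc a b
    · simp only [hB', indicator_of_mem ht]
      rw [intervalIntegral.integral_of_le ht.1.le, integral_Ioc_eq_integral_Ioo,
        ← integral_indicator measurableSet_Ioo]
      congr 2
      ext s
      by_cases hs : s ∈ Ioo a t
      · have h1 : t - s ∈ Ioc 0 (b - a) := ⟨by linarith [hs.2], by linarith [ht.2, hs.1]⟩
        have h2 : s ∈ Ioc a b := ⟨hs.1, by linarith [hs.2, ht.2]⟩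
        simp only [hKdef, hA', indicator_of_mem hs, indicator_of_mem h1, indicator_of_mem h2]
      · rw [indicator_of_notMem hs]
        rcases lt_or_ge s t with h | h
        · have h2 : s ∉ Ioc a b := fun h2 => hs ⟨h2.1, h⟩
          simp [hA', indicator_of_notMem h2]
        · have h1 : t - s ∉ Ioc 0 (b - a) := fun h1 => by linarith [h1.1]
          simp [hKdef, indicator_of_notMem h1]
    · simp [hB', indicator_of_notMem ht]
  refine ⟨?_, ?_, ?_⟩
  · rw [intervalIntegrable_iff_integrableOn_Ioc_of_le hab, ← integrable_indicator_iff
      measurableSet_Ioc]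
    exact hF.integral_prod_left.congr (.of_forall inner1)
  · rw [intervalIntegrable_iff_integrableOn_Ioc_of_le hab, ← integrable_indicator_iff
      measurableSet_Ioc]
    exact hF.integral_prod_right.congr (.of_forall inner2)
  · rw [intervalIntegral.integral_of_le hab, intervalIntegral.integral_of_le hab,
      ← integral_indicator measurableSet_Ioc, ← integral_indicator measurableSet_Ioc]
    simp only [← inner1, ← inner2]
    exact (integral_integral_swap hF).symm

theorem integral_rpow_mul_one_sub_rpow_pos {α : ℝ} (hα0 : 0 < α) (hα1 : α < 1) :
    0 < ∫ u in (0 : ℝ)..1, u ^ (-α) * (1 - u) ^ (α - 1) := by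
  refine intervalIntegral.intervalIntegral_pos_of_pos_on ?_ (fun u hu => ?_) zero_lt_one
  · refine IntervalIntegrable.trans (b := 1 / 2) ?_ (intervalIntegrable_sub_rpow_mul hα0 ?_)
    · refine (intervalIntegral.intervalIntegrable_rpow' (by linarith)).mul_continuousOn ?_
      rw [uIcc_of_le (by norm_num)]
      exact ContinuousOn.rpow_const (by fun_prop) fun u hu => Or.inl (by linarith [hu.2])
    · rw [uIcc_of_le (by norm_num)]
      exact ContinuousOn.rpow_const (by fun_prop) fun u hu => Or.inl (by simp; linarith [hu.1])
  · exact mul_pos (Real.rpow_pos_of_pos hu.1 _) (Real.rpow_pos_of_pos (by linarith [hu.2]) _)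

theorem integral_sub_rpow_mul_sub_rpow {α t x : ℝ} (htx : t < x) :
    ∫ y in t..x, (y - t) ^ (-α) * (x - y) ^ (α - 1)
      = ∫ u in (0 : ℝ)..1, u ^ (-α) * (1 - u) ^ (α - 1) := by
  have hc : 0 < x - t := sub_pos.2 htx
  have h := intervalIntegral.smul_integral_comp_mul_add (a := 0) (b := 1)
    (fun y => (y - t) ^ (-α) * (x - y) ^ (α - 1)) (x - t) t
  simp only [mul_zero, zero_add, mul_one, sub_add_cancel] at h
  rw [← h, smul_eq_mul, ← intervalIntegral.integral_const_mul]
  refine intervalIntegral.integral_congr fun u hu => ?_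
  rw [uIcc_of_le zero_le_one] at hu
  have e1 : (x - t) * u + t - t = (x - t) * u := by ring
  have e2 : x - ((x - t) * u + t) = (x - t) * (1 - u) := by ring
  simp only [e1, e2]
  rw [Real.mul_rpow hc.le hu.1, Real.mul_rpow hc.le (by linarith [hu.2]), Real.rpow_sub_one hc.ne',
    Real.rpow_neg hc.le]
  have : (x - t) ^ α ≠ 0 := (Real.rpow_pos_of_pos hc _).ne'
  field_simp

theorem exists_eq_integral_sub_rpow_mul {a b α : ℝ} (hab : a < b) (hα0 : 0 < α) (hα1 : α < 1)
    {g : ℝ → ℝ} (hg : ContinuousOn g (Icc a b))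
    (hd : ∀ x ∈ Icc a b, DifferentiableAt ℝ (leftRLFI a (1 - α) g) x)
    (hD : ContinuousOn (leftRLFD a α g) (Icc a b)) :
    ∃ ψ : ℝ → ℝ, ContinuousOn ψ (Icc a b) ∧
      ∀ᵐ x, x ∈ Ioc a b → g x = ∫ t in a..x, (x - t) ^ (α - 1) * ψ t := by
  set D := leftRLFD a α g with hDdef
  set c := 1 / Real.Gamma (1 - α) with hc
  have hcpos : 0 < c := by
    have := Real.Gamma_pos_of_pos (show 0 < 1 - α by linarith)
    positivity
  set β := ∫ u in (0 : ℝ)..1, u ^ (-α) * (1 - u) ^ (α - 1) with hβ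
  have hβpos : 0 < β := integral_rpow_mul_one_sub_rpow_pos hα0 hα1
  set G : ℝ → ℝ := fun t => ∫ s in a..t, (t - s) ^ (α - 1) * D s with hG
  have hgi : ∀ x ∈ Icc a b, IntervalIntegrable g volume a x := fun x hx =>
    (hg.mono (Icc_subset_Icc_right hx.2)).intervalIntegrable_of_Icc hx.1
  have hDi : ∀ x ∈ Icc a b, IntervalIntegrable D volume a x := fun x hx =>
    (hD.mono (Icc_subset_Icc_right hx.2)).intervalIntegrable_of_Icc hx.1
  have hmeas : ∀ {w : ℝ → ℝ} {x : ℝ}, x ∈ Icc a b → ContinuousOn w (Icc a b) →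
      AEStronglyMeasurable w (volume.restrict (Ioc a x)) := fun hx hw =>
    (hw.mono (Ioc_subset_Icc_self.trans (Icc_subset_Icc_right hx.2))).aestronglyMeasurable
      measurableSet_Ioc
  have hW : ∀ x ∈ Icc a b, leftRLFI a (1 - α) g x = ∫ t in a..x, D t := fun x hx => by
    have := intervalIntegral.integral_deriv_eq_sub (a := a) (b := x)
      (f := leftRLFI a (1 - α) g) (fun y hy => hd y ?_) (hDi x hx)
    · rw [hDdef]
      unfold leftRLFD
      rw [this]
      simp [leftRLFI]
    · rw [uIcc_of_le hx.1] at hy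
      exact ⟨hy.1, hy.2.trans hx.2⟩
  obtain ⟨Cg, hCg⟩ := isCompact_Icc.exists_bound_of_continuousOn hg
  obtain ⟨CD, hCD⟩ := isCompact_Icc.exists_bound_of_continuousOn hD
  have hkint : ∀ x, IntervalIntegrable (fun y => (x - y) ^ (α - 1)) volume a x := fun x => by
    simpa using intervalIntegrable_sub_rpow_mul (t := x) (a := a) (c := x) (w := fun _ => 1) hα0
      continuousOn_const
  have key : ∀ x ∈ Icc a b, c * β * ∫ t in a..x, g t = ∫ t in a..x, G t := fun x hx => by
    have h1 := (triangle_convolution (k := fun z => z ^ (-α)) hx.1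
      (intervalIntegral.intervalIntegrable_rpow' (by linarith)) (hmeas hx hg)
      (fun t ht => hCg t ⟨ht.1.le, ht.2.trans hx.2⟩) (hkint x)).2.2
    have h2 := (triangle_convolution (k := fun _ => 1) hx.1
      intervalIntegrable_const (hmeas hx hD)
      (fun t ht => hCD t ⟨ht.1.le, ht.2.trans hx.2⟩) (hkint x)).2.2
    have h3 := (triangle_convolution (k := fun z => z ^ (α - 1)) (B := fun _ => 1) hx.1
      (intervalIntegral.intervalIntegrable_rpow' (by linarith)) (hmeas hx hD)
      (fun t ht => hCD t ⟨ht.1.le, ht.2.trans hx.2⟩) intervalIntegrable_const).2.2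
    simp only [one_mul, mul_one] at h2 h3
    have e1 : ∫ s in a..x, g s * ∫ t in s..x, (t - s) ^ (-α) * (x - t) ^ (α - 1)
        = β * ∫ t in a..x, g t := by
      rw [← intervalIntegral.integral_const_mul]
      refine intervalIntegral.integral_congr_ae ?_
      have hne : ∀ᵐ t : ℝ, t ≠ x := by simp [ae_iff]
      filter_upwards [hne] with t ht1 ht2
      rw [uIoc_of_le hx.1] at ht2
      rw [integral_sub_rpow_mul_sub_rpow (lt_of_le_of_ne ht2.2 ht1), mul_comm]
    have e2 : ∀ s, ∫ t in s..x, (x - t) ^ (α - 1) = ∫ t in s..x, (t - s) ^ (α - 1) := fun s => by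
      rw [intervalIntegral.integral_comp_sub_left (fun z => z ^ (α - 1)),
        intervalIntegral.integral_comp_sub_right (fun z => z ^ (α - 1)), sub_self, sub_self]
    simp only [e2] at h2
    rw [hG, h3, ← h2, mul_assoc, ← e1, ← h1, ← intervalIntegral.integral_const_mul]
    refine intervalIntegral.integral_congr fun y hy => ?_
    rw [uIcc_of_le hx.1] at hy
    rw [← hW y ⟨hy.1, hy.2.trans hx.2⟩, leftRLFI, sub_sub_cancel_left]
    ring
  have hGi : IntervalIntegrable G volume a b := by
    have := (triangle_convolution (k := fun z => z ^ (α - 1)) (B := fun _ => 1) hab.le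
      (intervalIntegral.intervalIntegrable_rpow' (by linarith))
      (hmeas (right_mem_Icc.2 hab.le) hD)
      (fun t ht => hCD t ⟨ht.1.le, ht.2⟩) intervalIntegrable_const).2.1
    simpa only [one_mul] using this
  refine ⟨fun t => (c * β)⁻¹ * D t, continuousOn_const.mul hD, ?_⟩
  have hne : ∀ᵐ t : ℝ, t ≠ b := by simp [ae_iff]
  filter_upwards [hGi.ae_hasDerivAt_integral,
    (hgi b (right_mem_Icc.2 hab.le)).ae_hasDerivAt_integral, hne] with x hx1 hx2 hxb hx
  rw [uIcc_of_le hab.le] at hx1 hx2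
  have hx' : x ∈ Icc a b := Ioc_subset_Icc_self hx
  have d1 := hx1 hx' a (left_mem_Icc.2 hab.le)
  have d2 := (hx2 hx' a (left_mem_Icc.2 hab.le)).const_mul (c * β)
  have hev : (fun x => c * β * ∫ t in a..x, g t) =ᶠ[nhds x] fun x => ∫ t in a..x, G t := by
    filter_upwards [Ioo_mem_nhds hx.1 (lt_of_le_of_ne hx.2 hxb)] with y hy
    exact key y (Ioo_subset_Icc_self hy)
  have h := (d1.congr_of_eventuallyEq hev).unique d2
  have hG' : ∫ t in a..x, (x - t) ^ (α - 1) * ((c * β)⁻¹ * D t) = (c * β)⁻¹ * G x := by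
    rw [hG, ← intervalIntegral.integral_const_mul (c * β)⁻¹]
    refine intervalIntegral.integral_congr fun t _ => ?_
    ring
  rw [hG', h]
  have : c * β ≠ 0 := by positivity
  field_simp

theorem leftRLFI_comp_neg (b β : ℝ) (f : ℝ → ℝ) (x : ℝ) :
    leftRLFI (-b) β (fun t => f (-t)) (-x) = rightRLFI b β f x := by
  unfold leftRLFI rightRLFI
  rw [← intervalIntegral.integral_comp_neg]
  simp only [neg_neg]
  congr 2
  ext t
  ring_nf

theorem leftRLFD_comp_neg (b α : ℝ) (f : ℝ → ℝ) (x : ℝ) :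
    leftRLFD (-b) α (fun t => f (-t)) (-x) = rightRLFD b α f x := by
  have h : rightRLFI b (1 - α) f = fun x => leftRLFI (-b) (1 - α) (fun t => f (-t)) (-x) :=
    funext fun x => (leftRLFI_comp_neg b (1 - α) f x).symm
  unfold leftRLFD rightRLFD
  rw [h, deriv_comp_neg, neg_neg]

theorem exists_eq_integral_rpow_sub_mul {a b α : ℝ} (hab : a < b) (hα0 : 0 < α) (hα1 : α < 1)
    {f : ℝ → ℝ} (hf : ContinuousOn f (Icc a b))
    (hd : ∀ x ∈ Icc a b, DifferentiableAt ℝ (rightRLFI b (1 - α) f) x)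
    (hD : ContinuousOn (rightRLFD b α f) (Icc a b)) :
    ∃ φ : ℝ → ℝ, ContinuousOn φ (Icc a b) ∧
      ∀ᵐ x, x ∈ Ioc a b → f x = ∫ t in x..b, (t - x) ^ (α - 1) * φ t := by
  have hmaps : MapsTo (fun x : ℝ => -x) (Icc (-b) (-a)) (Icc a b) := fun x hx =>
    ⟨by linarith [hx.2], by linarith [hx.1]⟩
  have hcn : ∀ {w : ℝ → ℝ}, ContinuousOn w (Icc a b) →
      ContinuousOn (fun x => w (-x)) (Icc (-b) (-a)) := fun hw =>
    hw.comp continuous_neg.continuousOn hmaps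
  have hI : leftRLFI (-b) (1 - α) (fun t => f (-t)) = fun x => rightRLFI b (1 - α) f (-x) :=
    funext fun x => by rw [← leftRLFI_comp_neg, neg_neg]
  have hD' : leftRLFD (-b) α (fun t => f (-t)) = fun x => rightRLFD b α f (-x) :=
    funext fun x => by rw [← leftRLFD_comp_neg, neg_neg]
  obtain ⟨ψ, hψ, h⟩ := exists_eq_integral_sub_rpow_mul (neg_lt_neg hab) hα0 hα1 (hcn hf)
    (fun x hx => by
      rw [hI]
      exact (hd (-x) (hmaps hx)).comp x differentiable_neg.differentiableAt)
    (by rw [hD']; exact hcn hD)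
  refine ⟨fun x => ψ (-x), hψ.comp continuous_neg.continuousOn fun x hx =>
    ⟨neg_le_neg hx.2, neg_le_neg hx.1⟩, ?_⟩
  have hne : ∀ᵐ t : ℝ, t ≠ b := by simp [ae_iff]
  filter_upwards [(Measure.measurePreserving_neg volume).quasiMeasurePreserving.ae h, hne]
    with x hx hxb hxm
  have := hx ⟨neg_lt_neg (lt_of_le_of_ne hxm.2 hxb), neg_le_neg hxm.1.le⟩
  rw [neg_neg, ← intervalIntegral.integral_comp_neg] at this
  rw [this]
  congr 1
  ext t
  ring_nf

/-- The derivative at `x` of the regularized Abel integral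
`x ↦ ∫ s in a..x, (x - s + ε) ^ (-α) * f s`. -/
noncomputable def regularizedDeriv (a α ε : ℝ) (f : ℝ → ℝ) (x : ℝ) : ℝ :=
  ε ^ (-α) * f x - α * ∫ s in a..x, (x - s + ε) ^ (-α - 1) * f s

theorem intervalIntegrable_add_rpow {c ε r : ℝ} (hc : 0 ≤ c) (hε : 0 < ε) :
    IntervalIntegrable (fun z => (z + ε) ^ r) volume 0 c := by
  refine ContinuousOn.intervalIntegrable_of_Icc hc ?_
  exact ContinuousOn.rpow_const (by fun_prop) fun z hz => Or.inl (by linarith [hz.1])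

theorem intervalIntegrable_regularizedDeriv {a b α ε : ℝ} (hab : a ≤ b) (hε : 0 < ε) {f : ℝ → ℝ}
    (hf : ContinuousOn f (Icc a b)) :
    IntervalIntegrable (regularizedDeriv a α ε f) volume a b := by
  obtain ⟨C, hC⟩ := isCompact_Icc.exists_bound_of_continuousOn hf
  have := (triangle_convolution (k := fun z => (z + ε) ^ (-α - 1)) (B := fun _ => 1) hab
    (intervalIntegrable_add_rpow (by linarith) hε)
    ((hf.mono Ioc_subset_Icc_self).aestronglyMeasurable measurableSet_Ioc)
    (fun t ht => hC t (Ioc_subset_Icc_self ht)) intervalIntegrable_const).2.1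
  simp only [one_mul] at this
  exact ((hf.intervalIntegrable_of_Icc hab).const_mul _).sub (this.const_mul α)

theorem integral_regularizedDeriv {a x α ε : ℝ} (hax : a ≤ x) (hα0 : 0 < α) (hε : 0 < ε)
    {f : ℝ → ℝ} (hf : ContinuousOn f (Icc a x)) :
    ∫ t in a..x, regularizedDeriv a α ε f t = ∫ s in a..x, (x - s + ε) ^ (-α) * f s := by
  obtain ⟨C, hC⟩ := isCompact_Icc.exists_bound_of_continuousOn hf
  have h := triangle_convolution (k := fun z => (z + ε) ^ (-α - 1)) (B := fun _ => 1) hax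
    (intervalIntegrable_add_rpow (by linarith) hε)
    ((hf.mono Ioc_subset_Icc_self).aestronglyMeasurable measurableSet_Ioc)
    (fun t ht => hC t (Ioc_subset_Icc_self ht)) intervalIntegrable_const
  simp only [one_mul, mul_one] at h
  have hfi := (hf.intervalIntegrable_of_Icc hax (μ := volume)).const_mul (ε ^ (-α))
  unfold regularizedDeriv
  rw [intervalIntegral.integral_sub hfi (h.2.1.const_mul α), intervalIntegral.integral_const_mul α,
    h.2.2, ← intervalIntegral.integral_const_mul α,
    ← intervalIntegral.integral_sub hfi (h.1.const_mul α)]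
  refine intervalIntegral.integral_congr fun s hs => ?_
  rw [uIcc_of_le hax] at hs
  have e : ∫ t in s..x, (t - s + ε) ^ (-α - 1) = ((x - s + ε) ^ (-α) - ε ^ (-α)) / (-α) := by
    have h0 : (0 : ℝ) ∉ uIcc (0 + ε) (x - s + ε) := by
      rw [uIcc_of_le (by linarith [hs.2])]
      exact fun h => by linarith [h.1]
    rw [intervalIntegral.integral_comp_sub_right (fun z => (z + ε) ^ (-α - 1)), sub_self,
      intervalIntegral.integral_comp_add_right (fun z => z ^ (-α - 1)),
      integral_rpow (Or.inr ⟨by linarith, h0⟩)]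
    simp
  rw [e]
  field_simp
  ring

theorem integral_mul_regularizedDeriv {a b α ε : ℝ} (hab : a ≤ b) (hε : 0 < ε) {f g : ℝ → ℝ}
    (hf : ContinuousOn f (Icc a b)) (hg : ContinuousOn g (Icc a b)) :
    ∫ x in a..b, g x * regularizedDeriv a α ε f x
      = ∫ x in a..b, f x * regularizedDeriv (-b) α ε (fun t => g (-t)) (-x) := by
  obtain ⟨C, hC⟩ := isCompact_Icc.exists_bound_of_continuousOn hf
  have h := triangle_convolution (k := fun z => (z + ε) ^ (-α - 1)) (B := g) hab
    (intervalIntegrable_add_rpow (by linarith) hε)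
    ((hf.mono Ioc_subset_Icc_self).aestronglyMeasurable measurableSet_Ioc)
    (fun t ht => hC t (Ioc_subset_Icc_self ht)) (hg.intervalIntegrable_of_Icc hab)
  have hfg : IntervalIntegrable (fun x => ε ^ (-α) * (f x * g x)) volume a b :=
    ((hf.mul hg).intervalIntegrable_of_Icc hab).const_mul _
  have e1 : ∀ x, g x * regularizedDeriv a α ε f x = ε ^ (-α) * (f x * g x)
      - α * (g x * ∫ s in a..x, (x - s + ε) ^ (-α - 1) * f s) := fun x => by
    unfold regularizedDeriv
    ring
  have e2 : ∀ x, f x * regularizedDeriv (-b) α ε (fun t => g (-t)) (-x) = ε ^ (-α) * (f x * g x)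
      - α * (f x * ∫ t in x..b, (t - x + ε) ^ (-α - 1) * g t) := fun x => by
    unfold regularizedDeriv
    rw [← intervalIntegral.integral_comp_neg]
    simp only [neg_neg, neg_add_eq_sub, sub_neg_eq_add]
    ring
  simp only [e1, e2]
  rw [intervalIntegral.integral_sub hfg (h.2.1.const_mul α),
    intervalIntegral.integral_sub hfg (h.1.const_mul α), intervalIntegral.integral_const_mul α,
    h.2.2, ← intervalIntegral.integral_const_mul α]

theorem regularizedDeriv_eq_integral_shiftedKernel {a b α ε x : ℝ} (hα0 : 0 < α) (hε : 0 < ε)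
    (hx : x ∈ Ioc a b) {f φ : ℝ → ℝ} (hφ : ContinuousOn φ (Icc a b))
    (hf : ∀ᵐ s, s ∈ Ioc a b → f s = ∫ t in s..b, (t - s) ^ (α - 1) * φ t)
    (hfx : f x = ∫ t in x..b, (t - x) ^ (α - 1) * φ t) :
    IntervalIntegrable (fun t => φ t * shiftedKernel a α ε x t) volume a b ∧
    regularizedDeriv a α ε f x = ∫ t in a..b, φ t * shiftedKernel a α ε x t := by
  have hab : a ≤ b := hx.1.le.trans hx.2
  set A : ℝ → ℝ := (Ioc a x).indicator fun s => (x + ε - s) ^ (-α - 1) with hA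
  have hAm : AEStronglyMeasurable A (volume.restrict (Ioc a b)) :=
    (Measurable.indicator (by fun_prop) measurableSet_Ioc).aestronglyMeasurable
  have hAb : ∀ s ∈ Ioc a b, |A s| ≤ ε ^ (-α - 1) := fun s _ => by
    by_cases hs : s ∈ Ioc a x
    · have : ε ≤ x + ε - s := by linarith [hs.2]
      rw [hA, indicator_of_mem hs, abs_of_nonneg (Real.rpow_nonneg (hε.le.trans this) _)]
      exact Real.rpow_le_rpow_of_nonpos hε this (by linarith)
    · rw [hA, indicator_of_notMem hs, abs_zero]
      positivity
  obtain ⟨h1, h2, h3⟩ := triangle_convolution (k := fun z => z ^ (α - 1)) hab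
    (intervalIntegral.intervalIntegrable_rpow' (by linarith)) hAm hAb
    (hφ.intervalIntegrable_of_Icc hab)
  have e1 : ∀ t ∈ Icc a b, ∫ s in a..t, (t - s) ^ (α - 1) * A s
      = ∫ s in a..(min t x), (x + ε - s) ^ (-α - 1) * (t - s) ^ (α - 1) := fun t ht => by
    rw [intervalIntegral.integral_of_le ht.1, intervalIntegral.integral_of_le (le_min ht.1 hx.1.le)]
    have : Ioc a (min t x) = Ioc a t ∩ Ioc a x := by
      rw [Ioc_inter_Ioc, max_self]
    rw [this, ← setIntegral_indicator measurableSet_Ioc]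
    congr 1
    ext s
    by_cases hs : s ∈ Ioc a x
    · simp only [hA, indicator_of_mem hs, mul_comm]
    · simp only [hA, indicator_of_notMem hs, mul_zero]
  have e2 : ∫ s in a..x, (x - s + ε) ^ (-α - 1) * f s
      = ∫ s in a..b, A s * ∫ t in s..b, (t - s) ^ (α - 1) * φ t := by
    rw [intervalIntegral.integral_of_le hab, intervalIntegral.integral_of_le hx.1.le]
    have : Ioc a x = Ioc a b ∩ Ioc a x := by
      rw [Ioc_inter_Ioc, max_self, min_eq_right hx.2]
    rw [this, ← setIntegral_indicator measurableSet_Ioc]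
    refine setIntegral_congr_ae measurableSet_Ioc ?_
    filter_upwards [hf] with s hs hsab
    by_cases hsx : s ∈ Ioc a x
    · simp only [hA, indicator_of_mem hsx, ← hs hsab, add_sub_right_comm]
    · simp only [hA, indicator_of_notMem hsx, zero_mul]
  have hφx : IntervalIntegrable (fun t => (t - x) ^ (α - 1) * φ t) volume x b := by
    have := (intervalIntegral.intervalIntegrable_rpow' (a := x - x) (b := b - x)
      (r := α - 1) (by linarith)).comp_sub_right x
    simp only [sub_add_cancel] at this
    refine this.mul_continuousOn ?_
    rw [uIcc_of_le hx.2]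
    exact hφ.mono (Icc_subset_Icc_left hx.1.le)
  have hite : ∀ t, φ t * (if x < t then ε ^ (-α) * (t - x) ^ (α - 1) else 0)
      = (Ioi x).indicator (fun t => ε ^ (-α) * ((t - x) ^ (α - 1) * φ t)) t := fun t => by
    by_cases h : x < t
    · rw [if_pos h, indicator_of_mem (mem_Ioi.2 h)]
      ring
    · rw [if_neg h, indicator_of_notMem (by simpa using h), mul_zero]
  have hset : Ioc a b ∩ Ioi x = Ioc x b := by
    ext t
    simp only [mem_inter_iff, mem_Ioc, mem_Ioi]
    exact ⟨fun h => ⟨h.2, h.1.2⟩, fun h => ⟨⟨hx.1.trans h.1, h.2⟩, h.1⟩⟩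
  have h4 : IntervalIntegrable
      (fun t => φ t * (if x < t then ε ^ (-α) * (t - x) ^ (α - 1) else 0)) volume a b := by
    simp only [hite]
    rw [intervalIntegrable_iff_integrableOn_Ioc_of_le hab, IntegrableOn,
      integrable_indicator_iff measurableSet_Ioi, IntegrableOn,
      Measure.restrict_restrict measurableSet_Ioi, inter_comm, hset]
    exact ((intervalIntegrable_iff_integrableOn_Ioc_of_le hx.2).1 hφx).const_mul _
  have e3 : ε ^ (-α) * f x
      = ∫ t in a..b, φ t * (if x < t then ε ^ (-α) * (t - x) ^ (α - 1) else 0) := by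
    simp only [hite]
    rw [intervalIntegral.integral_of_le hab, setIntegral_indicator measurableSet_Ioi, hset, hfx,
      ← intervalIntegral.integral_of_le hx.2, intervalIntegral.integral_const_mul]
  have e4 : ∀ t ∈ Icc a b, φ t * (if x < t then ε ^ (-α) * (t - x) ^ (α - 1) else 0)
      - α * (φ t * ∫ s in a..t, (t - s) ^ (α - 1) * A s) = φ t * shiftedKernel a α ε x t :=
    fun t ht => by
      rw [e1 t ht, shiftedKernel]
      ring
  constructor
  · refine (h4.sub (h2.const_mul α)).congr fun t ht => ?_
    rw [uIoc_of_le hab] at ht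
    exact e4 t (Ioc_subset_Icc_self ht)
  · unfold regularizedDeriv
    rw [e2, ← h3, e3, ← intervalIntegral.integral_const_mul α,
      ← intervalIntegral.integral_sub h4 (h2.const_mul α)]
    refine intervalIntegral.integral_congr fun t ht => ?_
    rw [uIcc_of_le hab] at ht
    exact e4 t ht

theorem intervalIntegrable_abs_rpow {r : ℝ} (hr : -1 < r) (a b : ℝ) :
    IntervalIntegrable (fun y => |y| ^ r) volume a b := by
  refine intervalIntegrable_of_even (fun y => by rw [abs_neg]) fun x hx => ?_
  refine (intervalIntegral.intervalIntegrable_rpow' hr).congr fun y hy => ?_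
  rw [uIoc_of_le hx.le] at hy
  simp only [abs_of_pos hy.1]

theorem profileMajorant_nonneg (α z : ℝ) : 0 ≤ profileMajorant α z := by
  unfold profileMajorant
  refine add_nonneg (by positivity) (add_nonneg ?_ ?_)
  · exact indicator_nonneg (fun z hz => mul_nonneg zero_le_two (Real.rpow_nonneg hz.1.le _)) z
  · exact indicator_nonneg
      (fun z hz => mul_nonneg zero_le_two (Real.rpow_nonneg (zero_le_one.trans (le_of_lt hz)) _)) z

theorem intervalIntegrable_profileMajorant_scaled {α ε : ℝ} (hα0 : 0 < α) (hα1 : α < 1)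
    (hε : 0 < ε) (x a b : ℝ) :
    IntervalIntegrable (fun t => ε⁻¹ * profileMajorant α ((t - x) / ε)) volume a b :=
  ((((integrable_profileMajorant hα0 hα1).comp_div hε.ne').comp_sub_right x).const_mul
    _).intervalIntegrable

theorem integral_profileMajorant_scaled_le {α ε : ℝ} (hα0 : 0 < α) (hα1 : α < 1)
    (hε : 0 < ε) (x : ℝ) {a b : ℝ} (hab : a ≤ b) :
    ∫ t in a..b, ε⁻¹ * profileMajorant α ((t - x) / ε) ≤ ∫ z, profileMajorant α z := by
  have hint := (((integrable_profileMajorant hα0 hα1).comp_div hε.ne').comp_sub_right x).const_mul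
    ε⁻¹
  rw [intervalIntegral.integral_of_le hab]
  refine (setIntegral_le_integral hint (.of_forall fun t =>
    mul_nonneg (inv_nonneg.2 hε.le) (profileMajorant_nonneg _ _))).trans_eq ?_
  rw [integral_const_mul, integral_sub_right_eq_self (fun t => profileMajorant α (t / ε)),
    Measure.integral_comp_div, abs_of_pos hε, smul_eq_mul, inv_mul_cancel_left₀ hε.ne']

theorem abs_regularizedDeriv_sub_le {a b α ε M x : ℝ} (hα0 : 0 < α) (hα1 : α < 1) (hε : 0 < ε)
    (hε1 : ε ≤ 1) (hx : x ∈ Ioc a b) {f φ : ℝ → ℝ} (hφ : ContinuousOn φ (Icc a b))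
    (hM : ∀ t ∈ Icc a b, |φ t| ≤ M)
    (hf : ∀ᵐ s, s ∈ Ioc a b → f s = ∫ t in s..b, (t - s) ^ (α - 1) * φ t)
    (hfx : f x = ∫ t in x..b, (t - x) ^ (α - 1) * φ t) :
    |regularizedDeriv a α ε f x - ∫ t in a..b, φ t * conjPoisson ε (t - x)| ≤
      M * ((∫ z, profileMajorant α z)
        + (x - a) ^ (-α) * ∫ y in (-(b - a + 1))..(b - a + 1), |y| ^ (α - 1)) := by
  have hab : a ≤ b := hx.1.le.trans hx.2
  have hM0 : 0 ≤ M := (abs_nonneg _).trans (hM a (left_mem_Icc.2 hab))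
  obtain ⟨hi, he⟩ := regularizedDeriv_eq_integral_shiftedKernel hα0 hε hx hφ hf hfx
  have hp : IntervalIntegrable (fun t => φ t * conjPoisson ε (t - x)) volume a b := by
    refine (hφ.mul ?_).intervalIntegrable_of_Icc hab
    exact ((continuous_conjPoisson hε).comp (continuous_id.sub continuous_const)).continuousOn
  have hi1 := intervalIntegrable_profileMajorant_scaled hα0 hα1 hε x a b
  have hi2 : IntervalIntegrable (fun t => (x - a) ^ (-α) * |t - (x + ε)| ^ (α - 1))
      volume a b := by
    have := (intervalIntegrable_abs_rpow (show -1 < α - 1 by linarith) (a - (x + ε))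
      (b - (x + ε))).comp_sub_right (x + ε)
    simp only [sub_add_cancel] at this
    exact this.const_mul _
  rw [he, ← intervalIntegral.integral_sub hi hp, ← Real.norm_eq_abs]
  have hne : ∀ᵐ t : ℝ, t ≠ x := by simp [ae_iff]
  have hne' : ∀ᵐ t : ℝ, t ≠ x + ε := by simp [ae_iff]
  refine (intervalIntegral.norm_integral_le_of_norm_le hab
    (g := fun t => M * (ε⁻¹ * profileMajorant α ((t - x) / ε)
      + (x - a) ^ (-α) * |t - (x + ε)| ^ (α - 1))) ?_ ((hi1.add hi2).const_mul M)).trans ?_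
  · filter_upwards [hne, hne'] with t h1 h2 ht
    rw [← mul_sub, norm_mul, Real.norm_eq_abs, Real.norm_eq_abs]
    exact mul_le_mul (hM t (Ioc_subset_Icc_self ht))
      (abs_shiftedKernel_sub_conjPoisson_le hα0 hα1 hε hx.1 ht.1 h1 h2) (abs_nonneg _) hM0
  · rw [intervalIntegral.integral_const_mul, intervalIntegral.integral_add hi1 hi2,
      intervalIntegral.integral_const_mul ((x - a) ^ (-α))]
    refine mul_le_mul_of_nonneg_left (add_le_add
      (integral_profileMajorant_scaled_le hα0 hα1 hε x hab)
      (mul_le_mul_of_nonneg_left ?_ (Real.rpow_nonneg (by linarith [hx.1]) _))) hM0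
    rw [intervalIntegral.integral_comp_sub_right (fun y => |y| ^ (α - 1))]
    exact intervalIntegral.integral_mono_interval (by linarith [hx.2]) (by linarith)
      (by linarith [hx.1]) (.of_forall fun y => Real.rpow_nonneg (abs_nonneg y) _)
      (intervalIntegrable_abs_rpow (by linarith) _ _)

open Filter Topology in
theorem tendsto_integral_add_rpow_mul {a x α : ℝ} (hα0 : 0 < α) (hα1 : α < 1) (hax : a ≤ x)
    {f : ℝ → ℝ} (hf : ContinuousOn f (Icc a x)) {ε : ℕ → ℝ} (hε : ∀ n, 0 < ε n)
    (hε0 : Tendsto ε atTop (𝓝 0)) :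
    Tendsto (fun n => ∫ s in a..x, (x - s + ε n) ^ (-α) * f s) atTop
      (𝓝 (∫ s in a..x, (x - s) ^ (-α) * f s)) := by
  have hfu : ContinuousOn f (uIcc a x) := by rwa [uIcc_of_le hax]
  have hbi : IntervalIntegrable (fun s => (x - s) ^ (-α) * |f s|) volume a x := by
    have := (intervalIntegral.intervalIntegrable_rpow' (a := x - a) (b := x - x)
      (r := -α) (by linarith)).comp_sub_left x
    simp only [sub_sub_cancel] at this
    exact this.mul_continuousOn hfu.abs
  have hne : ∀ᵐ t : ℝ, t ≠ x := by simp [ae_iff]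
  refine intervalIntegral.tendsto_integral_filter_of_dominated_convergence _
    (.of_forall fun n => ?_) (.of_forall fun n => ?_) hbi ?_
  · rw [uIoc_of_le hax]
    exact (Measurable.aestronglyMeasurable (by fun_prop)).mul
      ((hf.mono Ioc_subset_Icc_self).aestronglyMeasurable measurableSet_Ioc)
  · filter_upwards [hne] with s h1 hs
    rw [uIoc_of_le hax] at hs
    have h0 : 0 < x - s := sub_pos.2 (lt_of_le_of_ne hs.2 h1)
    rw [norm_mul, Real.norm_eq_abs, Real.norm_eq_abs,
      abs_of_nonneg (Real.rpow_nonneg (by linarith [hε n]) _)]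
    exact mul_le_mul_of_nonneg_right
      (Real.rpow_le_rpow_of_nonpos h0 (by linarith [hε n]) (by linarith)) (abs_nonneg _)
  · filter_upwards [hne] with s h1 hs
    rw [uIoc_of_le hax] at hs
    have h0 : 0 < x - s := sub_pos.2 (lt_of_le_of_ne hs.2 h1)
    have : Tendsto (fun n => x - s + ε n) atTop (𝓝 (x - s)) := by
      simpa using hε0.const_add (x - s)
    exact (this.rpow_const (Or.inl h0.ne')).mul_const _

open Filter Topology in
theorem tendsto_integral_mul_regularizedDeriv {a b α : ℝ} (hab : a < b) (hα0 : 0 < α)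
    (hα1 : α < 1) {f g φ : ℝ → ℝ} (hf : ContinuousOn f (Icc a b)) (hg : ContinuousOn g (Icc a b))
    (hφ : ContinuousOn φ (Icc a b))
    (hfφ : ∀ᵐ s, s ∈ Ioc a b → f s = ∫ t in s..b, (t - s) ^ (α - 1) * φ t)
    {ε : ℕ → ℝ} (hε : ∀ n, 0 < ε n) (hε1 : ∀ n, ε n ≤ 1) (hε0 : Tendsto ε atTop (𝓝 0)) :
    Tendsto (fun n => ∫ x in a..b, g x * regularizedDeriv a α (ε n) f x) atTop
      (𝓝 (∫ x in a..b, g x * deriv (fun x => ∫ s in a..x, (x - s) ^ (-α) * f s) x)) := by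
  obtain ⟨M, hM⟩ := isCompact_Icc.exists_bound_of_continuousOn hφ
  set H : ℕ → ℝ → ℝ := fun n x => ∫ t in a..b, φ t * conjPoisson (ε n) (t - x) with hH
  set m : ℝ → ℝ := fun x => M * ((∫ z, profileMajorant α z)
    + (x - a) ^ (-α) * ∫ y in (-(b - a + 1))..(b - a + 1), |y| ^ (α - 1)) with hm
  have hV := fun n => intervalIntegrable_regularizedDeriv (α := α) hab.le (hε n) hf
  have hHs := fun n => integral_conjPoisson_convolution_sq_le hab.le (hε n)
    ((hφ.mono Ioc_subset_Icc_self).aestronglyMeasurable measurableSet_Ioc)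
    fun t ht => hM t (Ioc_subset_Icc_self ht)
  have hmi : IntervalIntegrable m volume a b := by
    have := (intervalIntegral.intervalIntegrable_rpow' (a := a - a) (b := b - a)
      (r := -α) (by linarith)).comp_sub_right a
    simp only [sub_add_cancel] at this
    exact (intervalIntegrable_const.add (this.mul_const _)).const_mul M
  have hbd : ∀ n, ∀ᵐ x, x ∈ Ioc a b → |regularizedDeriv a α (ε n) f x| ≤ |H n x| + m x :=
    fun n => by
      filter_upwards [hfφ] with x hx hxab
      have := abs_regularizedDeriv_sub_le hα0 hα1 (hε n) (hε1 n) hxab hφ hM hfφ (hx hxab)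
      have h2 := abs_sub_abs_le_abs_sub (regularizedDeriv a α (ε n) f x) (H n x)
      linarith
  have hu : ∀ x ∈ Icc a b, Tendsto (fun n => ∫ t in a..x, regularizedDeriv a α (ε n) f t) atTop
      (𝓝 (∫ s in a..x, (x - s) ^ (-α) * f s)) := fun x hx => by
    have hfx := hf.mono (Icc_subset_Icc_right hx.2)
    refine (tendsto_integral_add_rpow_mul hα0 hα1 hx.1 hfx hε hε0).congr fun n => ?_
    exact (integral_regularizedDeriv hx.1 hα0 (hε n) hfx).symm
  have hac := absolutelyContinuousOnInterval_of_tendsto_integral hab.le hV (fun n => (hHs n).1)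
    (fun n => (hHs n).2) hmi hbd hu
  refine tendsto_integral_mul_of_tendsto_integral
    (C := (M ^ 2 * Real.pi ^ 2 * (b - a) + (b - a)) / 2
    + ∫ x in a..b, m x) hab.le hV (fun n => ?_) hac hu hg
  have hi1 : IntervalIntegrable (fun x => (H n x ^ 2 + 1) / 2) volume a b :=
    ((hHs n).1.add intervalIntegrable_const).div_const 2
  calc ∫ x in a..b, |regularizedDeriv a α (ε n) f x|
      ≤ ∫ x in a..b, ((H n x ^ 2 + 1) / 2 + m x) := by
        rw [intervalIntegral.integral_of_le hab.le, intervalIntegral.integral_of_le hab.le]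
        refine setIntegral_mono_on_ae (hV n).abs.1 (hi1.add hmi).1 measurableSet_Ioc ?_
        filter_upwards [hbd n] with x hx hxab
        have h1 := hx hxab
        have h2 := sq_nonneg (|H n x| - 1)
        rw [sub_sq, sq_abs] at h2
        linarith
    _ ≤ _ := by
        rw [intervalIntegral.integral_add hi1 hmi, intervalIntegral.integral_div,
          intervalIntegral.integral_add (hHs n).1 intervalIntegrable_const,
          intervalIntegral.integral_const, smul_eq_mul, mul_one]
        linarith [(hHs n).2]

theorem leftRLFD_eq (a α : ℝ) (f : ℝ → ℝ) (x : ℝ) :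
    leftRLFD a α f x = 1 / Real.Gamma (1 - α) *
      deriv (fun x => ∫ s in a..x, (x - s) ^ (-α) * f s) x := by
  have h : leftRLFI a (1 - α) f
      = fun x => 1 / Real.Gamma (1 - α) * ∫ s in a..x, (x - s) ^ (-α) * f s := by
    funext x
    rw [leftRLFI, sub_sub_cancel_left]
  rw [leftRLFD, h, deriv_const_mul_field']

theorem integral_mul_leftRLFD (a c d α : ℝ) (f g : ℝ → ℝ) :
    ∫ x in c..d, g x * leftRLFD a α f x = 1 / Real.Gamma (1 - α) *
      ∫ x in c..d, g x * deriv (fun x => ∫ s in a..x, (x - s) ^ (-α) * f s) x := by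
  rw [← intervalIntegral.integral_const_mul]
  refine intervalIntegral.integral_congr fun x _ => ?_
  simp only [leftRLFD_eq]
  ring

/-- fractional integration by parts for Riemann-Liouville
fractional derivatives, `0 < α < 1`. -/
theorem fractional_integration_by_parts_RLFD
    (a b α : ℝ) (hab : a < b) (hα0 : 0 < α) (hα1 : α < 1)
    (f g : ℝ → ℝ)
    (hf : ContinuousOn f (Set.Icc a b))
    (hg : ContinuousOn g (Set.Icc a b))
    -- the left RLFD of `g` exists and is continuous on `[a,b]`
    (hDg_ex : ∀ x ∈ Set.Icc a b, DifferentiableAt ℝ (leftRLFI a (1 - α) g) x)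
    (hDg : ContinuousOn (leftRLFD a α g) (Set.Icc a b))
    -- the right RLFD of `f` exists and is continuous on `[a,b]`
    (hDf_ex : ∀ x ∈ Set.Icc a b, DifferentiableAt ℝ (rightRLFI b (1 - α) f) x)
    (hDf : ContinuousOn (rightRLFD b α f) (Set.Icc a b)) :
    ∫ x in a..b, g x * leftRLFD a α f x = ∫ x in a..b, f x * rightRLFD b α g x := by
  obtain ⟨φ, hφ, hfφ⟩ := exists_eq_integral_rpow_sub_mul hab hα0 hα1 hf hDf_ex hDf
  obtain ⟨ψ, hψ, hgψ⟩ := exists_eq_integral_sub_rpow_mul hab hα0 hα1 hg hDg_ex hDg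
  have hmaps : MapsTo (fun x : ℝ => -x) (Icc (-b) (-a)) (Icc a b) := fun x hx =>
    ⟨by linarith [hx.2], by linarith [hx.1]⟩
  have hcn : ∀ {w : ℝ → ℝ}, ContinuousOn w (Icc a b) →
      ContinuousOn (fun x => w (-x)) (Icc (-b) (-a)) := fun hw =>
    hw.comp continuous_neg.continuousOn hmaps
  have hgψ' : ∀ᵐ s, s ∈ Ioc (-b) (-a) →
      g (-s) = ∫ t in s..(-a), (t - s) ^ (α - 1) * ψ (-t) := by
    have hne : ∀ᵐ t : ℝ, t ≠ -a := by simp [ae_iff]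
    filter_upwards [(Measure.measurePreserving_neg volume).quasiMeasurePreserving.ae hgψ, hne]
      with s hs hsa hsm
    have hlt := lt_of_le_of_ne hsm.2 hsa
    have hrefl := intervalIntegral.integral_comp_neg (a := s) (b := -a)
      fun t => (-s - t) ^ (α - 1) * ψ t
    rw [neg_neg] at hrefl
    rw [hs ⟨by linarith, by linarith [hsm.1]⟩, ← hrefl]
    congr 1
    ext t
    ring_nf
  have hε : ∀ n : ℕ, (0 : ℝ) < 1 / ((n : ℝ) + 1) := fun n => by positivity
  have hε1 : ∀ n : ℕ, 1 / ((n : ℝ) + 1) ≤ 1 := fun n => by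
    rw [div_le_one (by positivity)]
    linarith [(Nat.cast_nonneg n : (0 : ℝ) ≤ n)]
  have hε0 := tendsto_one_div_add_atTop_nhds_zero_nat (𝕜 := ℝ)
  have hl := tendsto_integral_mul_regularizedDeriv hab hα0 hα1 hf hg hφ hfφ hε hε1 hε0
  have hr := tendsto_integral_mul_regularizedDeriv (neg_lt_neg hab) hα0 hα1 (hcn hg) (hcn hf)
    (hcn hψ) hgψ' hε hε1 hε0
  have hlim := tendsto_nhds_unique hl <| hr.congr fun n => by
    rw [integral_mul_regularizedDeriv hab.le (hε n) hf hg, ← intervalIntegral.integral_comp_neg]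
    simp only [neg_neg]
  have hright : ∫ x in a..b, f x * rightRLFD b α g x
      = ∫ x in (-b)..(-a), f (-x) * leftRLFD (-b) α (fun t => g (-t)) x := by
    rw [← intervalIntegral.integral_comp_neg]
    simp only [neg_neg, leftRLFD_comp_neg]
  rw [hright, integral_mul_leftRLFD, integral_mul_leftRLFD, hlim]
end

section
/- (Value of the functional along a solution of the exact-field equation.) Let 0 < α < 1, let L(x,u,v) be C¹, let Φ : D → ℝ be an exact field for L covering [a,b] × ℝ ⊆ D with associated function S ∈ C¹(D,ℝ), and let y₀ be a solution of the fractional equation (ₐD_x^α y₀)(x) = Φ(x, (ₐI_x^{1−α}y₀)(x)) on [a,b]. Then J(y₀) = S(b, (ₐI_b^{1−α}y₀)(b)) − S(a, (ₐI_a^{1−α}y₀)(a)), where J(y) = ∫_a^b L(x, ₐI_x^{1−α}y(x), ₐD_x^α y(x)) dx. -/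
open MeasureTheory Set

/-- Partial derivative of `L (x, u, v)` with respect to the second argument. -/
noncomputable def d2 (L : ℝ → ℝ → ℝ → ℝ) (x u v : ℝ) : ℝ :=
  deriv (fun u' => L x u' v) u

/-- Partial derivative of `L (x, u, v)` with respect to the third argument. -/
noncomputable def d3 (L : ℝ → ℝ → ℝ → ℝ) (x u v : ℝ) : ℝ :=
  deriv (fun v' => L x u v') v

/-- A function `y` is admissible when its left RLFI of order `1 - α` exists
(the defining integral converges) and its left RLFD of order `β` exists
(the fractional integral of order `1 - β` is differentiable) on `[a,b]`. -/
def Admissible (a b α β : ℝ) (y : ℝ → ℝ) : Prop :=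
  (∀ x ∈ Set.Icc a b,
      IntervalIntegrable (fun t => (x - t) ^ ((1 - α) - 1) * y t) MeasureTheory.volume a x) ∧
  (∀ x ∈ Set.Icc a b, DifferentiableAt ℝ (leftRLFI a (1 - β) y) x)

/-- The fractional variational functional
`J(y) = ∫_a^b L (x, (ₐI_x^{1-α} y)(x), (ₐD_x^β y)(x)) dx`. -/
noncomputable def J (a b α β : ℝ) (L : ℝ → ℝ → ℝ → ℝ) (y : ℝ → ℝ) : ℝ :=
  ∫ x in a..b, L x (leftRLFI a (1 - α) y x) (leftRLFD a β y x)

/-- `y` is a local minimizer of `J` among admissible variations: for every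
admissible variation `η`, the map `ε ↦ J (y + ε η)` has a local minimum at `0`. -/
def IsLocalMinimizer (a b α β : ℝ) (L : ℝ → ℝ → ℝ → ℝ) (y : ℝ → ℝ) : Prop :=
  ∀ η : ℝ → ℝ, Admissible a b α β η →
    IsLocalMin (fun ε : ℝ => J a b α β L (fun x => y x + ε * η x)) 0
/-- Partial derivative of `S (x, y)` with respect to the first argument. -/
noncomputable def dS1 (S : ℝ → ℝ → ℝ) (x y : ℝ) : ℝ := deriv (fun x' => S x' y) x

/-- Partial derivative of `S (x, y)` with respect to the second argument. -/
noncomputable def dS2 (S : ℝ → ℝ → ℝ) (x y : ℝ) : ℝ := deriv (fun y' => S x y') y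

/-- `Φ` is an exact field for `L` covering `D`, with associated `C¹` function `S`:
`∂₁S(x,y) = L(x,y,Φ(x,y)) − ∂₃L(x,y,Φ(x,y))·Φ(x,y)` and
`∂₂S(x,y) = ∂₃L(x,y,Φ(x,y))` on `D`. -/
def IsExactField (L : ℝ → ℝ → ℝ → ℝ) (D : Set (ℝ × ℝ))
    (Φ S : ℝ → ℝ → ℝ) : Prop :=
  ContDiffOn ℝ 1 (fun p : ℝ × ℝ => Φ p.1 p.2) D ∧
  ContDiffOn ℝ 1 (fun p : ℝ × ℝ => S p.1 p.2) D ∧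
  (∀ p ∈ D, dS1 S p.1 p.2
      = L p.1 p.2 (Φ p.1 p.2) - d3 L p.1 p.2 (Φ p.1 p.2) * Φ p.1 p.2) ∧
  (∀ p ∈ D, dS2 S p.1 p.2 = d3 L p.1 p.2 (Φ p.1 p.2))

/-- Chain rule for `x ↦ S (x, u x)` in terms of the partial derivatives of `S`. -/
theorem hasDerivAt_comp_graph {S : ℝ → ℝ → ℝ} {u : ℝ → ℝ} {x u' : ℝ}
    (hS : DifferentiableAt ℝ (fun p : ℝ × ℝ => S p.1 p.2) (x, u x)) (hu : HasDerivAt u u' x) :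
    HasDerivAt (fun t => S t (u t)) (dS1 S x (u x) + dS2 S x (u x) * u') x := by
  have hF := hS.hasFDerivAt
  set F := fderiv ℝ (fun p : ℝ × ℝ => S p.1 p.2) (x, u x)
  have h1 : HasDerivAt (fun t => S t (u x)) (F (1, 0)) x :=
    HasFDerivAt.comp_hasDerivAt (f := fun t => (t, u x)) x hF
      ((hasDerivAt_id x).prodMk (hasDerivAt_const x (u x)))
  have h2 : HasDerivAt (fun y => S x y) (F (0, 1)) (u x) :=
    hF.comp_hasDerivAt (u x) ((hasDerivAt_const (u x) x).prodMk (hasDerivAt_id (u x)))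
  have h3 : HasDerivAt (fun t => S t (u t)) (F (1, u')) x :=
    HasFDerivAt.comp_hasDerivAt (f := fun t => (t, u t)) x hF
      ((hasDerivAt_id x).prodMk hu)
  have hsum : F (1, u') = F (1, 0) + F (0, 1) * u' := by
    have : ((1, u') : ℝ × ℝ) = (1, 0) + u' • (0, 1) := by simp
    rw [this, map_add, map_smul, smul_eq_mul, mul_comm]
  rw [dS1, dS2, h1.deriv, h2.deriv, ← hsum]
  exact h3

/-- along a solution `y₀` of `(ₐD_x^α y₀)(x) = Φ(x, (ₐI_x^{1-α}y₀)(x))`,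
the value of the functional is `J(y₀) = S(b, ₐI_b^{1-α}y₀(b)) − S(a, ₐI_a^{1-α}y₀(a))`. -/
theorem value_along_exact_field_solution
    (a b α : ℝ) (hab : a < b) (hα0 : 0 < α) (hα1 : α < 1)
    (L : ℝ → ℝ → ℝ → ℝ)
    (hL : ContDiffOn ℝ 1 (fun p : ℝ × ℝ × ℝ => L p.1 p.2.1 p.2.2)
      (Set.Icc a b ×ˢ (Set.univ : Set (ℝ × ℝ))))
    (D : Set (ℝ × ℝ)) (hD : Set.Icc a b ×ˢ (Set.univ : Set ℝ) ⊆ D)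
    (Φ S : ℝ → ℝ → ℝ) (hexact : IsExactField L D Φ S)
    (y₀ : ℝ → ℝ) (hy₀ : Admissible a b α α y₀)
    -- `y₀` solves the fractional equation `ₐD_x^α y₀ = Φ(x, ₐI_x^{1-α} y₀)` on `[a,b]`
    (hsol : ∀ x ∈ Set.Icc a b,
      leftRLFD a α y₀ x = Φ x (leftRLFI a (1 - α) y₀ x)) :
    J a b α α L y₀
      = S b (leftRLFI a (1 - α) y₀ b) - S a (leftRLFI a (1 - α) y₀ a) := by
  obtain ⟨hΦ, hS, h1, h2⟩ := hexact
  have hud : ∀ x ∈ Icc a b, HasDerivAt (leftRLFI a (1 - α) y₀) (leftRLFD a α y₀ x) x :=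
    fun x hx => (hy₀.2 x hx).hasDerivAt
  set u := leftRLFI a (1 - α) y₀
  have huc : ContinuousOn u (Icc a b) := fun x hx => (hud x hx).continuousAt.continuousWithinAt
  have hgraph : ContinuousOn (fun x => (x, u x)) (Icc a b) := continuousOn_id.prodMk huc
  have hmem : MapsTo (fun x => (x, u x)) (Icc a b) D := fun x hx => hD ⟨hx, mem_univ _⟩
  have hvc : ContinuousOn (leftRLFD a α y₀) (Icc a b) :=
    (hΦ.continuousOn.comp hgraph hmem).congr hsol
  have hLc : ContinuousOn (fun x => L x (u x) (leftRLFD a α y₀ x)) (Icc a b) :=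
    hL.continuousOn.comp (continuousOn_id.prodMk (huc.prodMk hvc)) fun x hx => ⟨hx, mem_univ _⟩
  refine intervalIntegral.integral_eq_sub_of_hasDerivAt_of_le hab.le
    (f := fun x => S x (u x)) (hS.continuousOn.comp hgraph hmem) (fun x hx => ?_)
    (hLc.intervalIntegrable_of_Icc hab.le)
  have hx' := Ioo_subset_Icc_self hx
  have hnhds : D ∈ nhds (x, u x) :=
    Filter.mem_of_superset (prod_mem_nhds (Icc_mem_nhds hx.1 hx.2) Filter.univ_mem) hD
  have hdiff := (hS.contDiffAt hnhds).differentiableAt one_ne_zero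
  have hchain := hasDerivAt_comp_graph hdiff (hud x hx')
  rw [h1 _ (hmem hx'), h2 _ (hmem hx')] at hchain
  rw [hsol x hx'] at hchain ⊢
  simpa only [sub_add_cancel] using hchain
end
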